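/- arXiv:math-ph/0605039 — 2 statements merged into one kernel-verified Lean document; each statement's English description precedes it below -/
import Mathlib

section
/- Let E be a closed real-linear subspace of S₂(H). Then [X, [X, Y]] ∈ E for all X, Y ∈ E if and only if exp(X) · exp(Y) · exp(X) ∈ exp E for all X, Y ∈ E. -/
noncomputable section

open scoped InnerProductSpace

variable {H : Type*} [NormedAddCommGroup H] [InnerProductSpace ℂ H] [CompleteSpace H]
variable {ι : Type*}

/-- `A` is a Hilbert–Schmidt operator (w.r.t. the Hilbert basis `e`). -/
def IsHS (e : HilbertBasis ι ℂ H) (A : H →L[ℂ] H) : Prop :=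
  Summable fun i => ‖A (e i)‖ ^ 2

/-- The Hilbert–Schmidt norm of `A` (w.r.t. the Hilbert basis `e`). -/
def hsNorm (e : HilbertBasis ι ℂ H) (A : H →L[ℂ] H) : ℝ :=
  Real.sqrt (∑' i, ‖A (e i)‖ ^ 2)

/-- The real Hilbert–Schmidt inner product `⟨A, B⟩₂ = ∑ ⟪A eᵢ, B eᵢ⟫`. -/
def hsInner (e : HilbertBasis ι ℂ H) (A B : H →L[ℂ] H) : ℝ :=
  (∑' i, (inner ℂ (A (e i)) (B (e i)) : ℂ)).re

/-- The trace of an operator, `Tr T = ∑ ⟪eᵢ, T eᵢ⟫`. -/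
def opTrace (e : HilbertBasis ι ℂ H) (T : H →L[ℂ] H) : ℂ :=
  ∑' i, (inner ℂ (e i) (T (e i)) : ℂ)

/-- `T` is trace class: it is the product of two Hilbert–Schmidt operators. -/
def IsTraceClass (e : HilbertBasis ι ℂ H) (T : H →L[ℂ] H) : Prop :=
  ∃ B C : H →L[ℂ] H, IsHS e B ∧ IsHS e C ∧ T = B * C

/-- `A ∈ S₂(H)`: self-adjoint and Hilbert–Schmidt. -/
def MemS2 (e : HilbertBasis ι ℂ H) (A : H →L[ℂ] H) : Prop :=
  IsSelfAdjoint A ∧ IsHS e A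

/-- `p ∈ P`: self-adjoint, positive definite (invertible and `⟪p x, x⟫ ≥ 0`),
with `p - 1` Hilbert–Schmidt. -/
def MemP (e : HilbertBasis ι ℂ H) (p : H →L[ℂ] H) : Prop :=
  IsSelfAdjoint p ∧ IsUnit p ∧ (∀ x : H, 0 ≤ (inner ℂ (p x) x : ℂ).re) ∧ IsHS e (p - 1)

/-- `x ∈ GL₂(H)`: invertible with `x - 1` Hilbert–Schmidt. -/
def MemGL2 (e : HilbertBasis ι ℂ H) (x : H →L[ℂ] H) : Prop :=
  IsUnit x ∧ IsHS e (x - 1)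

/-- `x ∈ U₂(H)`: unitary with `x - 1` Hilbert–Schmidt. -/
def MemU2 (e : HilbertBasis ι ℂ H) (x : H →L[ℂ] H) : Prop :=
  x ∈ unitary (H →L[ℂ] H) ∧ IsHS e (x - 1)

/-- `p^{1/2}`, via continuous functional calculus. -/
def psqrt (p : H →L[ℂ] H) : H →L[ℂ] H := cfc Real.sqrt p

/-- `p^{-1/2}`, via continuous functional calculus. -/
def pinvsqrt (p : H →L[ℂ] H) : H →L[ℂ] H := cfc (fun t : ℝ => (Real.sqrt t)⁻¹) p

/-- `log p`, via continuous functional calculus. -/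
def plog (p : H →L[ℂ] H) : H →L[ℂ] H := cfc Real.log p

/-- The geodesic distance `d(p, q) = ‖log (p^{-1/2} q p^{-1/2})‖₂`. -/
def gdist (e : HilbertBasis ι ℂ H) (p q : H →L[ℂ] H) : ℝ :=
  hsNorm e (plog (pinvsqrt p * q * pinvsqrt p))

/-- The commutator `[A, B] = AB - BA`. -/
def brk (A B : H →L[ℂ] H) : H →L[ℂ] H := A * B - B * A

/-- The constant-speed geodesic `t ↦ p^{1/2} exp(t K) p^{1/2}`. -/
def geoCurve (p K : H →L[ℂ] H) (t : ℝ) : H →L[ℂ] H :=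
  psqrt p * NormedSpace.exp (t • K) * psqrt p

/-- The geodesic from `p` to `q`:
`t ↦ p^{1/2} exp(t log(p^{-1/2} q p^{-1/2})) p^{1/2}`. -/
def geodesic (p q : H →L[ℂ] H) (t : ℝ) : H →L[ℂ] H :=
  geoCurve p (plog (pinvsqrt p * q * pinvsqrt p)) t

/-- The image `exp E` of a set of operators under the exponential map. -/
def expSet (E : Set (H →L[ℂ] H)) : Set (H →L[ℂ] H) := NormedSpace.exp '' E

/-- The orthogonal complement of `E` inside `S₂(H)` for the Hilbert–Schmidt
inner product. -/
def hsPerp (e : HilbertBasis ι ℂ H) (E : Set (H →L[ℂ] H)) : Set (H →L[ℂ] H) :=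
  {Y | MemS2 e Y ∧ ∀ X ∈ E, hsInner e X Y = 0}

/-- `E` is closed in `S₂(H)` with respect to the Hilbert–Schmidt norm. -/
def IsHSClosed (e : HilbertBasis ι ℂ H) (E : Set (H →L[ℂ] H)) : Prop :=
  ∀ X : H →L[ℂ] H, MemS2 e X → (∀ ε > (0:ℝ), ∃ Y ∈ E, hsNorm e (X - Y) < ε) → X ∈ E

section Helpers

set_option linter.unusedSectionVars false

open NormedSpace Filter Topology

section GenExp
variable {A : Type*} [NormedRing A] [NormedAlgebra ℂ A] [CompleteSpace A]

theorem gexp_add {x y : A} (h : Commute x y) : exp (x + y) = exp x * exp y := by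
  let _ : NormedAlgebra ℚ A := NormedAlgebra.restrictScalars ℚ ℂ A
  exact NormedSpace.exp_add_of_commute h

theorem gexp_cont : Continuous (exp : A → A) := by
  let _ : NormedAlgebra ℚ A := NormedAlgebra.restrictScalars ℚ ℂ A
  exact NormedSpace.exp_continuous

theorem gexp_mul_neg (x : A) : exp x * exp (-x) = 1 := by
  rw [← gexp_add (Commute.neg_right (Commute.refl x))]; simp

theorem gexp_neg_mul (x : A) : exp (-x) * exp x = 1 := by
  rw [← gexp_add (Commute.neg_left (Commute.refl x))]; simp

theorem gexp_smul_add (s t : ℝ) (x : A) : exp (s • x) * exp (t • x) = exp ((s + t) • x) := by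
  rw [add_smul, gexp_add]
  exact ((Commute.refl x).smul_left s).smul_right t

theorem gnorm_exp_le (h1 : ‖(1 : A)‖ ≤ 1) (x : A) : ‖exp x‖ ≤ Real.exp ‖x‖ := by
  have h := exp_series_hasSum_exp' (𝕂 := ℂ) x
  have h2 : HasSum (fun n : ℕ => ((n.factorial : ℝ)⁻¹) • ‖x‖ ^ n) (exp ‖x‖) :=
    exp_series_hasSum_exp' (𝕂 := ℝ) ‖x‖
  rw [Real.exp_eq_exp_ℝ]
  rw [← h.tsum_eq]
  refine tsum_of_norm_bounded h2 (fun n => ?_)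
  rw [norm_smul, norm_inv, smul_eq_mul]
  simp only [Complex.norm_natCast]
  gcongr
  rcases n.eq_zero_or_pos with rfl | hn
  · simpa using h1
  · exact norm_pow_le' x hn

end GenExp

theorem cnorm_one_le (B : Type*) [CStarAlgebra B] : ‖(1 : B)‖ ≤ 1 := by
  rcases subsingleton_or_nontrivial B with h | h
  · rw [Subsingleton.elim (1 : B) 0]; simp
  · rw [CStarRing.norm_one]

theorem cnorm_exp_le {B : Type*} [CStarAlgebra B] (x : B) : ‖exp x‖ ≤ Real.exp ‖x‖ :=
  gnorm_exp_le (cnorm_one_le B) x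

/-- operator norm control of the logarithm -/
theorem norm_le_exp_add {B : Type*} [CStarAlgebra B] (z : B) (hz : IsSelfAdjoint z) :
    ‖z‖ ≤ ‖exp z‖ + ‖exp (-z)‖ := by
  have h1 : cfc Real.exp z = exp z := CFC.real_exp_eq_normedSpace_exp hz
  have h2 : cfc (fun x => Real.exp (-x)) z = exp (-z) := by
    rw [← CFC.real_exp_eq_normedSpace_exp hz.neg, ← cfc_comp_neg Real.exp z]
  have k1 := (norm_cfc_le_iff (𝕜 := ℝ) Real.exp z (norm_nonneg (cfc Real.exp z))
    (by fun_prop) hz).1 le_rfl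
  have k2 := (norm_cfc_le_iff (𝕜 := ℝ) (fun x => Real.exp (-x)) z
    (norm_nonneg (cfc (fun x => Real.exp (-x)) z)) (by fun_prop) hz).1 le_rfl
  rw [h1] at k1
  rw [h2] at k2
  have : ‖cfc (fun x : ℝ => x) z‖ ≤ ‖exp z‖ + ‖exp (-z)‖ := by
    rw [norm_cfc_le_iff (𝕜 := ℝ) (fun x : ℝ => x) z (by positivity) (by fun_prop) hz]
    intro x hx
    have a := k1 x hx
    have b := k2 x hx
    rw [Real.norm_of_nonneg (Real.exp_pos _).le] at a b
    have := Real.add_one_le_exp x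
    have := Real.add_one_le_exp (-x)
    have := Real.exp_pos x
    have := Real.exp_pos (-x)
    rw [Real.norm_eq_abs, abs_le]
    constructor <;> linarith
  rwa [cfc_id' ℝ z] at this

structure HSData (B K : Type*) [CStarAlgebra B] [NormedAddCommGroup K]
    [InnerProductSpace ℂ K] where
  T : K →L[ℂ] B
  L : B →L[ℂ] (K →L[ℂ] K)
  R : B →L[ℂ] (K →L[ℂ] K)
  T_inj : Function.Injective T
  norm_T : ∀ x, ‖T x‖ ≤ ‖x‖
  T_L : ∀ a x, T (L a x) = a * T x
  T_R : ∀ a x, T (R a x) = T x * a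
  norm_L : ∀ a x, ‖L a x‖ ≤ ‖a‖ * ‖x‖
  norm_R : ∀ a x, ‖R a x‖ ≤ ‖a‖ * ‖x‖
  inner_L : ∀ a x y, inner ℂ (L a x) y = inner ℂ x (L (star a) y)
  inner_R : ∀ a x y, inner ℂ (R a x) y = inner ℂ x (R (star a) y)

namespace HSData
variable {B K : Type*} [CStarAlgebra B] [NormedAddCommGroup K] [InnerProductSpace ℂ K]
  [CompleteSpace K] (D : HSData B K)

theorem L_mul (a b : B) (x : K) : D.L (a * b) x = D.L a (D.L b x) := by
  apply D.T_inj; simp [D.T_L, mul_assoc]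

theorem R_mul (a b : B) (x : K) : D.R (a * b) x = D.R b (D.R a x) := by
  apply D.T_inj; simp [D.T_R, mul_assoc]

theorem LR_comm (a b : B) (x : K) : D.L a (D.R b x) = D.R b (D.L a x) := by
  apply D.T_inj; simp [D.T_R, D.T_L, mul_assoc]

theorem L_one (x : K) : D.L 1 x = x := by
  apply D.T_inj; simp [D.T_L]

theorem R_one (x : K) : D.R 1 x = x := by
  apply D.T_inj; simp [D.T_R]

theorem norm_LR (a b : B) (x : K) : ‖D.L a (D.R b x)‖ ≤ ‖a‖ * ‖b‖ * ‖x‖ := by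
  refine (D.norm_L _ _).trans ?_
  rw [mul_assoc]
  gcongr
  exact D.norm_R _ _

theorem cont_LR {a b : ℝ → B} (ha : Continuous a) (hb : Continuous b) (d : K) :
    Continuous fun t => D.L (a t) (D.R (b t) d) := by
  have h1 : Continuous fun t => D.L (a t) := D.L.continuous.comp ha
  have h2 : Continuous fun t => D.R (b t) := D.R.continuous.comp hb
  exact h1.clm_apply (h2.clm_apply continuous_const)

theorem cont_exp_smul {f : ℝ → ℝ} (hf : Continuous f) (z : B) :
    Continuous fun t => exp (f t • z) :=
  gexp_cont.comp (hf.smul continuous_const)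

/-- Duhamel integral. -/
def I (z b : B) (d : K) : K := ∫ t in (0:ℝ)..1, D.L (exp ((1 - t) • z)) (D.R (exp (t • b)) d)

theorem T_I (z b : B) (d : K) (h : b = z + D.T d) : D.T (D.I z b d) = exp b - exp z := by
  have hc : Continuous fun t : ℝ => D.L (exp ((1 - t) • z)) (D.R (exp (t • b)) d) :=
    D.cont_LR (cont_exp_smul (by fun_prop) z) (cont_exp_smul (f := fun t => t) (by fun_prop) b) d
  rw [I, ← D.T.intervalIntegral_comp_comm (hc.intervalIntegrable _ _)]
  have hF : ∀ t : ℝ, HasDerivAt (fun t : ℝ => exp ((1 - t) • z) * exp (t • b))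
      (D.T (D.L (exp ((1 - t) • z)) (D.R (exp (t • b)) d))) t := by
    intro t
    have h1 : HasDerivAt (fun t : ℝ => exp ((1 - t) • z)) (-(exp ((1 - t) • z) * z)) t := by
      have := (hasDerivAt_exp_smul_const z (1 - t)).scomp t ((hasDerivAt_id t).const_sub 1)
      simpa [Function.comp_def] using this
    have h2 := hasDerivAt_exp_smul_const' b t
    have h3 := h1.mul h2
    have h4 : D.T (D.L (exp ((1 - t) • z)) (D.R (exp (t • b)) d)) =
        -(exp ((1 - t) • z) * z) * exp (t • b) + exp ((1 - t) • z) * (b * exp (t • b)) := by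
      have h5 : D.T d = b - z := by rw [h]; simp
      rw [D.T_L, D.T_R, h5]
      noncomm_ring
    rw [h4]
    exact h3
  rw [intervalIntegral.integral_eq_sub_of_hasDerivAt (fun t _ => hF t)
    ((D.T.continuous.comp hc).intervalIntegrable _ _)]
  simp

theorem norm_exp_smul_le (z : B) (t r : ℝ) (ht : |t| ≤ 1) (hz : ‖z‖ ≤ r) :
    ‖exp (t • z)‖ ≤ Real.exp r := by
  refine (cnorm_exp_le _).trans (Real.exp_le_exp.2 ?_)
  rw [norm_smul, Real.norm_eq_abs]
  nlinarith [norm_nonneg z, abs_nonneg t]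

theorem LR_lower (a b : B) (ha : IsSelfAdjoint a) (hb : IsSelfAdjoint b) (r : ℝ)
    (har : ‖a‖ ≤ r) (hbr : ‖b‖ ≤ r) (d : K) :
    Real.exp (-4 * r) * ‖d‖ ^ 2 ≤ (inner ℂ d (D.L (exp a) (D.R (exp b) d))).re := by
  set u := D.L (exp ((1/2 : ℝ) • a)) (D.R (exp ((1/2 : ℝ) • b)) d) with hu
  have e1 : exp a = exp ((1/2 : ℝ) • a) * exp ((1/2 : ℝ) • a) := by
    rw [gexp_smul_add]; norm_num
  have e2 : exp b = exp ((1/2 : ℝ) • b) * exp ((1/2 : ℝ) • b) := by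
    rw [gexp_smul_add]; norm_num
  have s1 : star (exp ((1/2 : ℝ) • a)) = exp ((1/2 : ℝ) • a) :=
    (IsSelfAdjoint.exp ((IsSelfAdjoint.all (1/2 : ℝ)).smul ha)).star_eq
  have s2 : star (exp ((1/2 : ℝ) • b)) = exp ((1/2 : ℝ) • b) :=
    (IsSelfAdjoint.exp ((IsSelfAdjoint.all (1/2 : ℝ)).smul hb)).star_eq
  have h1 : inner ℂ d (D.L (exp a) (D.R (exp b) d)) = inner ℂ u u := by
    rw [hu, D.inner_L, D.inner_R, s1, s2, e1, e2, L_mul, R_mul, LR_comm, LR_comm, LR_comm]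
  have h2 : d = D.L (exp ((-1/2 : ℝ) • a)) (D.R (exp ((-1/2 : ℝ) • b)) u) := by
    rw [hu, ← LR_comm, ← L_mul, ← R_mul, gexp_smul_add, gexp_smul_add]
    norm_num [L_one, R_one]
  have h3 : ‖d‖ ≤ Real.exp r * Real.exp r * ‖u‖ := by
    conv_lhs => rw [h2]
    refine (D.norm_LR _ _ _).trans ?_
    gcongr
    · exact norm_exp_smul_le _ _ _ (by rw [abs_le]; constructor <;> norm_num) har
    · exact norm_exp_smul_le _ _ _ (by rw [abs_le]; constructor <;> norm_num) hbr
  have h6 : (inner ℂ u u).re = ‖u‖ ^ 2 := inner_self_eq_norm_sq (𝕜 := ℂ) u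
  rw [h1, h6]
  have h4 : ‖d‖ ^ 2 ≤ (Real.exp r * Real.exp r * ‖u‖) ^ 2 := by gcongr
  have h5 : (Real.exp r * Real.exp r * ‖u‖) ^ 2 = Real.exp (4 * r) * ‖u‖ ^ 2 := by
    rw [show 4 * r = r + r + (r + r) by ring, Real.exp_add, Real.exp_add]; ring
  calc Real.exp (-4 * r) * ‖d‖ ^ 2 ≤ Real.exp (-4 * r) * (Real.exp (4 * r) * ‖u‖ ^ 2) := by
        gcongr; linarith
    _ = ‖u‖ ^ 2 := by
        rw [← mul_assoc, ← Real.exp_add]; simp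

theorem int_lower {a b : ℝ → B} (hac : Continuous a) (hbc : Continuous b)
    (ha : ∀ t, IsSelfAdjoint (a t)) (hb : ∀ t, IsSelfAdjoint (b t)) (r : ℝ)
    (har : ∀ t ∈ Set.Icc (0:ℝ) 1, ‖a t‖ ≤ r) (hbr : ∀ t ∈ Set.Icc (0:ℝ) 1, ‖b t‖ ≤ r) (d : K) :
    Real.exp (-4 * r) * ‖d‖ ^ 2 ≤
      (inner ℂ d (∫ t in (0:ℝ)..1, D.L (exp (a t)) (D.R (exp (b t)) d))).re := by
  have hc : Continuous fun t : ℝ => D.L (exp (a t)) (D.R (exp (b t)) d) :=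
    D.cont_LR (gexp_cont.comp hac) (gexp_cont.comp hbc) d
  have h1 : (inner ℂ d (∫ t in (0:ℝ)..1, D.L (exp (a t)) (D.R (exp (b t)) d))).re
      = ∫ t in (0:ℝ)..1, (inner ℂ d (D.L (exp (a t)) (D.R (exp (b t)) d))).re := by
    have i1 := (innerSL ℂ d).intervalIntegral_comp_comm (hc.intervalIntegrable 0 1
      (μ := MeasureTheory.volume))
    have hc2 := (innerSL ℂ d).continuous.comp hc
    have i2 := Complex.reCLM.intervalIntegral_comp_comm (hc2.intervalIntegrable 0 1
      (μ := MeasureTheory.volume))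
    simp only [Function.comp_def, innerSL_apply_apply, Complex.reCLM_apply] at i1 i2
    rw [i2, i1]
  rw [h1]
  have h2 : ∫ t in (0:ℝ)..1, Real.exp (-4 * r) * ‖d‖ ^ 2 = Real.exp (-4 * r) * ‖d‖ ^ 2 := by simp
  rw [← h2]
  apply intervalIntegral.integral_mono_on zero_le_one
  · simp
  · apply Continuous.intervalIntegrable
    exact Complex.continuous_re.comp ((innerSL ℂ d).continuous.comp hc)
  · intro t ht
    exact D.LR_lower _ _ (ha t) (hb t) r (har t ht) (hbr t ht) d

theorem norm_of_inner {d x : K} {c : ℝ}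
    (h : Real.exp (-4 * c) * ‖d‖ ^ 2 ≤ (inner ℂ d x).re) : ‖d‖ ≤ Real.exp (4 * c) * ‖x‖ := by
  have h1 : (inner ℂ d x).re ≤ ‖d‖ * ‖x‖ :=
    (Complex.re_le_norm _).trans (norm_inner_le_norm d x)
  have h2 : Real.exp (-4 * c) * ‖d‖ ≤ ‖x‖ := by
    rcases eq_or_lt_of_le (norm_nonneg d) with h0 | h0
    · rw [← h0]; simp
    · nlinarith
  calc ‖d‖ = Real.exp (4 * c) * (Real.exp (-4 * c) * ‖d‖) := by
        rw [← mul_assoc, ← Real.exp_add]; simp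
    _ ≤ _ := by gcongr

theorem log_lip (x y w : K) (hx : IsSelfAdjoint (D.T x)) (hy : IsSelfAdjoint (D.T y)) (r : ℝ)
    (hxr : ‖D.T x‖ ≤ r) (hyr : ‖D.T y‖ ≤ r) (hw : D.T w = exp (D.T x) - exp (D.T y)) :
    ‖x - y‖ ≤ Real.exp (4 * r) * ‖w‖ := by
  have hr : 0 ≤ r := (norm_nonneg _).trans hxr
  have h1 : D.T (D.I (D.T y) (D.T x) (x - y)) = exp (D.T x) - exp (D.T y) := by
    apply D.T_I; simp
  have h2 : w = D.I (D.T y) (D.T x) (x - y) := D.T_inj (by rw [hw, h1])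
  apply norm_of_inner
  rw [h2]
  apply D.int_lower (a := fun t => (1 - t) • D.T y) (b := fun t => t • D.T x) (by fun_prop)
    (by fun_prop)
  · intro t; exact (IsSelfAdjoint.all _).smul hy
  · intro t; exact (IsSelfAdjoint.all _).smul hx
  · intro t ht
    rw [norm_smul, Real.norm_eq_abs, abs_of_nonneg (by linarith [ht.2])]
    nlinarith [ht.1, ht.2, norm_nonneg (D.T y)]
  · intro t ht
    rw [norm_smul, Real.norm_eq_abs, abs_of_nonneg (by linarith [ht.1])]
    nlinarith [ht.1, ht.2, norm_nonneg (D.T x)]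

end HSData

namespace HSData
variable {B K : Type*} [CStarAlgebra B] [NormedAddCommGroup K] [InnerProductSpace ℂ K]
  [CompleteSpace K] (D : HSData B K)

theorem norm_I_le (z b : B) (d : K) (r : ℝ) (hz : ‖z‖ ≤ r) (hb : ‖b‖ ≤ r) :
    ‖D.I z b d‖ ≤ Real.exp r * Real.exp r * ‖d‖ := by
  have := intervalIntegral.norm_integral_le_of_norm_le_const (a := 0) (b := 1)
    (f := fun t : ℝ => D.L (exp ((1 - t) • z)) (D.R (exp (t • b)) d))
    (C := Real.exp r * Real.exp r * ‖d‖) ?_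
  · simpa [I] using this
  · intro t ht
    rw [Set.uIoc_of_le zero_le_one] at ht
    refine (D.norm_LR _ _ _).trans ?_
    gcongr
    · exact norm_exp_smul_le _ _ _ (abs_le.2 ⟨by linarith [ht.2], by linarith [ht.1]⟩) hz
    · exact norm_exp_smul_le _ _ _ (abs_le.2 ⟨by linarith [ht.1], by linarith [ht.2]⟩) hb

theorem exp_lip (z b : B) (d : K) (h : b = z + D.T d) (r : ℝ) (hz : ‖z‖ ≤ r) (hb : ‖b‖ ≤ r) :
    ‖exp b - exp z‖ ≤ Real.exp r * Real.exp r * ‖d‖ := by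
  rw [← D.T_I z b d h]
  exact (D.norm_T _).trans (D.norm_I_le z b d r hz hb)

def S (z : B) (d : K) : K :=
  ∫ t in (0:ℝ)..1, D.L (exp ((1/2 - t) • z)) (D.R (exp ((t - 1/2) • z)) d)

theorem cont_S (z : B) (d : K) :
    Continuous fun t : ℝ => D.L (exp ((1/2 - t) • z)) (D.R (exp ((t - 1/2) • z)) d) :=
  D.cont_LR (cont_exp_smul (by fun_prop) z) (cont_exp_smul (by fun_prop) z) d

theorem cont_Ii (z b : B) (d : K) :
    Continuous fun t : ℝ => D.L (exp ((1 - t) • z)) (D.R (exp (t • b)) d) :=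
  D.cont_LR (cont_exp_smul (by fun_prop) z) (cont_exp_smul (f := fun t => t) (by fun_prop) b) d

theorem I_self (z : B) (d : K) :
    D.I z z d = D.L (exp ((1/2 : ℝ) • z)) (D.R (exp ((1/2 : ℝ) • z)) (D.S z d)) := by
  have hc := D.cont_S z d
  rw [S]
  have h := ((D.L (exp ((1/2 : ℝ) • z))).comp
    (D.R (exp ((1/2 : ℝ) • z)))).intervalIntegral_comp_comm (hc.intervalIntegrable 0 1
      (μ := MeasureTheory.volume))
  simp only [ContinuousLinearMap.comp_apply] at h
  rw [← h, I]
  congr 1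
  ext t
  rw [← LR_comm, ← L_mul, ← R_mul, gexp_smul_add, gexp_smul_add]
  congr 3
  · ring_nf
  · ring_nf

theorem dexp (z : B) (d : K) (r : ℝ) (hz : ‖z‖ ≤ r) (hb : ‖z + D.T d‖ ≤ r) :
    ∃ ρ : K, exp (z + D.T d) = exp z +
      D.T (D.L (exp ((1/2 : ℝ) • z)) (D.R (exp ((1/2 : ℝ) • z)) (D.S z d))) + D.T ρ ∧
      ‖ρ‖ ≤ Real.exp (3 * r) * ‖d‖ ^ 2 := by
  refine ⟨D.I z (z + D.T d) d - D.I z z d, ?_, ?_⟩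
  · rw [← I_self, map_sub, D.T_I z (z + D.T d) d rfl]
    abel
  · rw [I, I, ← intervalIntegral.integral_sub ((D.cont_Ii _ _ _).intervalIntegrable _ _)
      ((D.cont_Ii _ _ _).intervalIntegrable _ _)]
    have := intervalIntegral.norm_integral_le_of_norm_le_const (a := 0) (b := 1)
      (f := fun t : ℝ => D.L (exp ((1 - t) • z)) (D.R (exp (t • (z + D.T d))) d) -
        D.L (exp ((1 - t) • z)) (D.R (exp (t • z)) d))
      (C := Real.exp (3 * r) * ‖d‖ ^ 2) ?_
    · simpa using this
    · intro t ht
      rw [Set.uIoc_of_le zero_le_one] at ht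
      have h1 : D.L (exp ((1 - t) • z)) (D.R (exp (t • (z + D.T d))) d) -
        D.L (exp ((1 - t) • z)) (D.R (exp (t • z)) d) =
        D.L (exp ((1 - t) • z)) (D.R (exp (t • (z + D.T d)) - exp (t • z)) d) := by
        simp
      rw [h1]
      refine (D.norm_LR _ _ _).trans ?_
      have h2 : ‖exp ((1 - t) • z)‖ ≤ Real.exp r :=
        norm_exp_smul_le _ _ _ (abs_le.2 ⟨by linarith [ht.2], by linarith [ht.1]⟩) hz
      have ht1 : |t| ≤ 1 := abs_le.2 ⟨by linarith [ht.1], by linarith [ht.2]⟩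
      have h5 : ∀ x : B, ‖x‖ ≤ r → ‖t • x‖ ≤ r := by
        intro x hx
        rw [norm_smul, Real.norm_eq_abs]
        nlinarith [norm_nonneg x, abs_nonneg t]
      have h3 : ‖exp (t • (z + D.T d)) - exp (t • z)‖ ≤ Real.exp r * Real.exp r * ‖t • d‖ := by
        apply D.exp_lip _ _ _ _ _ (h5 _ hz) (h5 _ hb)
        rw [smul_add, ← Complex.coe_smul t d, map_smul, Complex.coe_smul]
      have h4 : ‖t • d‖ ≤ ‖d‖ := by
        rw [norm_smul, Real.norm_eq_abs]
        nlinarith [norm_nonneg d, abs_nonneg t]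
      calc _ ≤ Real.exp r * (Real.exp r * Real.exp r * ‖d‖) * ‖d‖ := by
            gcongr
            exact h3.trans (by gcongr)
        _ = _ := by
            rw [show 3 * r = r + r + r by ring, Real.exp_add, Real.exp_add]; ring

/-- first order expansion at the identity -/
theorem exp_one (d : K) (r : ℝ) (hd : ‖d‖ ≤ r) :
    ∃ ρ : K, exp (D.T d) = 1 + D.T d + D.T ρ ∧ ‖ρ‖ ≤ Real.exp (3 * r) * ‖d‖ ^ 2 := by
  obtain ⟨ρ, h1, h2⟩ := D.dexp 0 d r (by simpa using (norm_nonneg d).trans hd)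
    (by simpa using (D.norm_T d).trans hd)
  refine ⟨ρ, ?_, h2⟩
  have : D.S 0 d = d := by simp [S, L_one, R_one]
  simpa [this, L_one, R_one] using h1

theorem S_sub (z : B) (x y : K) : D.S z (x - y) = D.S z x - D.S z y := by
  rw [S, S, S, ← intervalIntegral.integral_sub ((D.cont_S _ _).intervalIntegrable _ _)
      ((D.cont_S _ _).intervalIntegrable _ _)]
  simp

theorem norm_S_le (z : B) (d : K) (r : ℝ) (hz : ‖z‖ ≤ r) :
    ‖D.S z d‖ ≤ Real.exp r * Real.exp r * ‖d‖ := by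
  have := intervalIntegral.norm_integral_le_of_norm_le_const (a := 0) (b := 1)
    (f := fun t : ℝ => D.L (exp ((1/2 - t) • z)) (D.R (exp ((t - 1/2) • z)) d))
    (C := Real.exp r * Real.exp r * ‖d‖) ?_
  · simpa [S] using this
  · intro t ht
    rw [Set.uIoc_of_le zero_le_one] at ht
    refine (D.norm_LR _ _ _).trans ?_
    gcongr
    · exact norm_exp_smul_le _ _ _ (abs_le.2 ⟨by linarith [ht.2], by linarith [ht.1]⟩) hz
    · exact norm_exp_smul_le _ _ _ (abs_le.2 ⟨by linarith [ht.1], by linarith [ht.2]⟩) hz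

theorem S_lower (z : B) (hsa : IsSelfAdjoint z) (r : ℝ) (hz : ‖z‖ ≤ r) (d : K) :
    Real.exp (-4 * r) * ‖d‖ ^ 2 ≤ (inner ℂ d (D.S z d)).re := by
  have key : ∀ s : ℝ, |s| ≤ 1 → ‖s • z‖ ≤ r := by
    intro s hs
    rw [norm_smul, Real.norm_eq_abs]
    nlinarith [norm_nonneg z, abs_nonneg s]
  apply D.int_lower (a := fun t => (1/2 - t) • z) (b := fun t => (t - 1/2) • z) (by fun_prop)
    (by fun_prop)
  · intro t; exact (IsSelfAdjoint.all _).smul hsa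
  · intro t; exact (IsSelfAdjoint.all _).smul hsa
  · intro t ht
    exact key _ (abs_le.2 ⟨by linarith [ht.2], by linarith [ht.1]⟩)
  · intro t ht
    exact key _ (abs_le.2 ⟨by linarith [ht.1], by linarith [ht.2]⟩)

def ad (z : B) : K →L[ℂ] K := D.L z - D.R z

theorem T_ad (z : B) (d : K) : D.T (D.ad z d) = z * D.T d - D.T d * z := by
  simp [ad, D.T_L, D.T_R]

theorem L_exp (z : B) : D.L (exp z) = exp (D.L z) := by
  have h1 := (exp_series_hasSum_exp' (𝕂 := ℂ) z).mapL D.L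
  have h2 := exp_series_hasSum_exp' (𝕂 := ℂ) (D.L z)
  have h3 : (fun n : ℕ => D.L (((n.factorial : ℂ)⁻¹) • z ^ n)) =
      fun n : ℕ => ((n.factorial : ℂ)⁻¹) • (D.L z) ^ n := by
    funext n
    rw [map_smul]
    congr 1
    induction n with
    | zero => ext x; simp [L_one]
    | succ n ih => ext x; simp [pow_succ, L_mul, ih]
  rw [h3] at h1
  exact h1.unique h2

theorem R_exp (z : B) : D.R (exp z) = exp (D.R z) := by
  have h1 := (exp_series_hasSum_exp' (𝕂 := ℂ) z).mapL D.R
  have h2 := exp_series_hasSum_exp' (𝕂 := ℂ) (D.R z)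
  have h3 : (fun n : ℕ => D.R (((n.factorial : ℂ)⁻¹) • z ^ n)) =
      fun n : ℕ => ((n.factorial : ℂ)⁻¹) • (D.R z) ^ n := by
    funext n
    rw [map_smul]
    congr 1
    induction n with
    | zero => ext x; simp [R_one]
    | succ n ih =>
      ext x
      rw [pow_succ' z, pow_succ, R_mul, ih]; simp
  rw [h3] at h1
  exact h1.unique h2

theorem exp_ad (z : B) (d : K) : exp (D.ad z) d = D.L (exp z) (D.R (exp (-z)) d) := by
  have h : Commute (D.L z) (D.R (-z)) := by
    ext x; simp [LR_comm]
  have h2 : D.ad z = D.L z + D.R (-z) := by simp [ad, sub_eq_add_neg]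
  rw [h2, gexp_add h, ← L_exp, ← R_exp]
  rfl

theorem ad_smul (c : ℝ) (z : B) : D.ad (c • z) = (c : ℂ) • D.ad z := by
  rw [← Complex.coe_smul]
  simp [ad, smul_sub]

theorem cosh_mem (E : Submodule ℝ K) (hE : IsClosed (E : Set K)) (z : B)
    (hz : ∀ d ∈ E, D.ad z (D.ad z d) ∈ E) (c : ℝ) (d : K) (hd : d ∈ E) :
    D.L (exp (c • z)) (D.R (exp ((-c) • z)) d) + D.L (exp ((-c) • z)) (D.R (exp (c • z)) d) ∈ E := by
  have h1 : D.L (exp (c • z)) (D.R (exp ((-c) • z)) d) = exp (D.ad (c • z)) d := by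
    rw [exp_ad]; simp
  have h2 : D.L (exp ((-c) • z)) (D.R (exp (c • z)) d) = exp (D.ad ((-c) • z)) d := by
    rw [exp_ad]; simp
  rw [h1, h2]
  have k : ∀ c : ℝ, HasSum (fun n : ℕ => ((n.factorial : ℝ)⁻¹ * c ^ n) • ((D.ad z) ^ n) d)
      (exp (D.ad (c • z)) d) := by
    intro c
    have := (exp_series_hasSum_exp' (𝕂 := ℂ) (D.ad (c • z))).mapL
      (ContinuousLinearMap.apply ℂ K d)
    have h3 : (fun n : ℕ => ContinuousLinearMap.apply ℂ K d
        (((n.factorial : ℂ)⁻¹) • (D.ad (c • z)) ^ n)) =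
        fun n : ℕ => ((n.factorial : ℝ)⁻¹ * c ^ n) • ((D.ad z) ^ n) d := by
      funext n
      rw [ad_smul, ← Complex.coe_smul, smul_pow, smul_smul]
      simp only [Complex.ofReal_mul, Complex.ofReal_pow, Complex.ofReal_inv,
        Complex.ofReal_natCast]
      rfl
    rw [h3] at this
    exact this
  have hs := (k c).add (k (-c))
  have pe : ∀ n, ((D.ad z) ^ (2 * n)) d ∈ E := by
    intro n
    induction n with
    | zero => simpa using hd
    | succ n ih =>
      have := hz _ ih
      rw [show 2 * (n + 1) = 2 * n + 1 + 1 by ring, pow_succ', pow_succ']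
      exact this
  refine hE.mem_of_tendsto hs (Eventually.of_forall fun s => ?_)
  refine E.sum_mem fun n _ => ?_
  rcases Nat.even_or_odd' n with ⟨m, rfl | rfl⟩
  · exact E.add_mem (E.smul_mem _ (pe m)) (E.smul_mem _ (pe m))
  · rw [← add_smul, Odd.neg_pow ⟨m, rfl⟩]
    simp

theorem integral_mem (E : Submodule ℝ K) (hE : IsClosed (E : Set K)) (f : ℝ → K)
    (hf : Continuous f) (h : ∀ t, f t ∈ E) : ∫ t in (0:ℝ)..1, f t ∈ E := by
  have : CompleteSpace E := hE.isComplete.completeSpace_coe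
  let g : ℝ → E := fun t => ⟨f t, h t⟩
  have hg : Continuous g := hf.subtype_mk h
  have := E.subtypeL.intervalIntegral_comp_comm (hg.intervalIntegrable 0 1
      (μ := MeasureTheory.volume))
  have h2 : ∫ t in (0:ℝ)..1, f t = E.subtypeL (∫ t in (0:ℝ)..1, g t) := by
    rw [← this]; rfl
  rw [h2]
  exact Submodule.coe_mem _

theorem S_mem (E : Submodule ℝ K) (hE : IsClosed (E : Set K)) (z : B)
    (hz : ∀ d ∈ E, D.ad z (D.ad z d) ∈ E) (d : K) (hd : d ∈ E) : D.S z d ∈ E := by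
  have h1 : D.S z d = ∫ t in (0:ℝ)..1, D.L (exp ((t - 1/2) • z)) (D.R (exp ((1/2 - t) • z)) d) := by
    have := intervalIntegral.integral_comp_sub_left (a := 0) (b := 1)
      (fun t : ℝ => D.L (exp ((1/2 - t) • z)) (D.R (exp ((t - 1/2) • z)) d)) 1
    simp only [sub_zero, sub_self] at this
    rw [S, ← this]
    congr 1
    ext t
    congr 3
    · ring_nf
    · ring_nf
  have hc2 : Continuous fun t : ℝ => D.L (exp ((t - 1/2) • z)) (D.R (exp ((1/2 - t) • z)) d) :=
    D.cont_LR (cont_exp_smul (by fun_prop) z) (cont_exp_smul (by fun_prop) z) d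
  have h2 : D.S z d + D.S z d ∈ E := by
    have h4 : D.S z d + D.S z d =
        (∫ t in (0:ℝ)..1, D.L (exp ((t - 1/2) • z)) (D.R (exp ((1/2 - t) • z)) d)) +
        ∫ t in (0:ℝ)..1, D.L (exp ((1/2 - t) • z)) (D.R (exp ((t - 1/2) • z)) d) := by
      rw [← h1]; rfl
    rw [h4, ← intervalIntegral.integral_add (hc2.intervalIntegrable _ _)
      ((D.cont_S z d).intervalIntegrable _ _)]
    apply integral_mem E hE _ (hc2.add (D.cont_S z d))
    intro t
    have := D.cosh_mem E hE z hz (t - 1/2) d hd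
    simpa using this
  have h3 : D.S z d = (1/2 : ℝ) • (D.S z d + D.S z d) := by
    rw [← two_smul ℝ, smul_smul]; norm_num
  rw [h3]
  exact E.smul_mem _ h2

theorem solve (E : Submodule ℝ K) (hE : IsClosed (E : Set K)) (z : B) (hsa : IsSelfAdjoint z)
    (hz : ∀ d ∈ E, D.ad z (D.ad z d) ∈ E) (r : ℝ) (hr : ‖z‖ ≤ r) (w : K) (hw : w ∈ E) :
    ∃ v ∈ E, D.S z v = w ∧ ‖v‖ ≤ Real.exp (4 * r) * ‖w‖ := by
  have hr0 : 0 ≤ r := (norm_nonneg _).trans hr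
  set m := Real.exp (-4 * r) with hm
  set M := Real.exp r * Real.exp r with hM
  have hmp : 0 < m := Real.exp_pos _
  have hMp : 0 < M := by positivity
  set δ := m / M ^ 2 with hδ
  have hδp : 0 < δ := by positivity
  set q := 1 - m ^ 2 / M ^ 2 with hq
  have hq1 : q < 1 := by
    have : 0 < m ^ 2 / M ^ 2 := by positivity
    linarith
  have hest : ∀ v : K, ‖v - δ • D.S z v‖ ^ 2 ≤ q * ‖v‖ ^ 2 := by
    intro v
    have e1 := norm_sub_sq (𝕜 := ℂ) v (δ • D.S z v)
    have e2 : RCLike.re (inner ℂ v (δ • D.S z v)) = δ * (inner ℂ v (D.S z v)).re := by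
      rw [← Complex.coe_smul, inner_smul_right]
      simp
    have e3 := D.S_lower z hsa r hr v
    have e4 := D.norm_S_le z v r hr
    rw [e1, e2, norm_smul, Real.norm_of_nonneg hδp.le]
    have e5 : (δ * ‖D.S z v‖) ^ 2 ≤ (δ * (M * ‖v‖)) ^ 2 := by gcongr
    have e6 : δ * (m * ‖v‖ ^ 2) ≤ δ * (inner ℂ v (D.S z v)).re := by gcongr
    have e7 : (δ * (M * ‖v‖)) ^ 2 = m ^ 2 / M ^ 2 * ‖v‖ ^ 2 := by
      rw [hδ]; field_simp
    have e8 : δ * (m * ‖v‖ ^ 2) = m ^ 2 / M ^ 2 * ‖v‖ ^ 2 := by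
      rw [hδ]; field_simp
    rw [hq]
    nlinarith
  set κ : NNReal := NNReal.sqrt q.toNNReal with hκ
  have hκ1 : κ < 1 := by
    rw [hκ, ← NNReal.sqrt_one, NNReal.sqrt_lt_sqrt]
    exact Real.toNNReal_lt_one.2 hq1
  have hest2 : ∀ v : K, ‖v - δ • D.S z v‖ ≤ κ * ‖v‖ := by
    intro v
    apply le_of_sq_le_sq _ (by positivity)
    rw [mul_pow, ← NNReal.coe_pow, hκ, NNReal.sq_sqrt]
    refine (hest v).trans ?_
    gcongr
    exact Real.le_coe_toNNReal q
  let f : K → K := fun v => v - δ • (D.S z v - w)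
  have hmaps : Set.MapsTo f (E : Set K) (E : Set K) := fun v hv =>
    E.sub_mem hv (E.smul_mem _ (E.sub_mem (D.S_mem E hE z hz v hv) hw))
  have hcon : ContractingWith κ (hmaps.restrict f E E) := by
    refine ⟨hκ1, LipschitzWith.of_dist_le_mul fun x y => ?_⟩
    rw [Subtype.dist_eq, Subtype.dist_eq, dist_eq_norm, dist_eq_norm]
    have := hest2 (x - y)
    rw [S_sub] at this
    have h9 : ((x : K) - δ • (D.S z x - w)) - ((y : K) - δ • (D.S z y - w)) =
        x - y - δ • (D.S z x - D.S z y) := by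
      simp only [smul_sub]
      abel
    rw [← h9] at this
    exact this
  obtain ⟨v, hv, hfix, -⟩ := hcon.exists_fixedPoint' hE.isComplete hmaps E.zero_mem (edist_ne_top _ _)
  have hS : D.S z v = w := by
    have : v - δ • (D.S z v - w) = v := hfix
    have h0 : δ • (D.S z v - w) = 0 := by simpa using this
    exact sub_eq_zero.1 ((smul_eq_zero.1 h0).resolve_left hδp.ne')
  refine ⟨v, hv, hS, ?_⟩
  apply norm_of_inner
  rw [← hS]
  exact D.S_lower z hsa r hr v

end HSData

namespace HSData
variable {B K : Type*} [CStarAlgebra B] [NormedAddCommGroup K] [InnerProductSpace ℂ K]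
  [CompleteSpace K] (D : HSData B K)

theorem T_smul (c : ℝ) (x : K) : D.T (c • x) = c • D.T x := by
  rw [← Complex.coe_smul c x, map_smul, Complex.coe_smul]

theorem L_smul (c : ℝ) (a : B) (x : K) : D.L a (c • x) = c • D.L a x := by
  rw [← Complex.coe_smul c x, map_smul, Complex.coe_smul]

theorem R_smul (c : ℝ) (a : B) (x : K) : D.R a (c • x) = c • D.R a x := by
  rw [← Complex.coe_smul c x, map_smul, Complex.coe_smul]

theorem exp_small (x : K) (h : ℝ) (h0 : 0 ≤ h) (h1 : h ≤ 1) :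
    ∃ ρ : K, exp (h • D.T x) = 1 + D.T (h • x + ρ) ∧
      ‖ρ‖ ≤ h ^ 2 * (Real.exp (3 * ‖x‖) * ‖x‖ ^ 2) ∧
      ‖h • x + ρ‖ ≤ h * (‖x‖ + Real.exp (3 * ‖x‖) * ‖x‖ ^ 2) := by
  have hn : ‖h • x‖ = h * ‖x‖ := by rw [norm_smul, Real.norm_of_nonneg h0]
  obtain ⟨ρ, e1, e2⟩ := D.exp_one (h • x) ‖x‖ (by rw [hn]; nlinarith [norm_nonneg x])
  have e3 : ‖ρ‖ ≤ h ^ 2 * (Real.exp (3 * ‖x‖) * ‖x‖ ^ 2) := by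
    rw [hn] at e2
    calc ‖ρ‖ ≤ _ := e2
      _ = _ := by ring
  refine ⟨ρ, ?_, e3, ?_⟩
  · rw [← T_smul, e1, map_add]; abel
  · have := norm_add_le (h • x) ρ
    rw [hn] at this
    have hp : 0 ≤ Real.exp (3 * ‖x‖) * ‖x‖ ^ 2 := by positivity
    nlinarith [mul_nonneg h0 (sub_nonneg.2 h1), mul_nonneg (mul_nonneg h0 (sub_nonneg.2 h1)) hp]

theorem step (E : Submodule ℝ K) (hE : IsClosed (E : Set K))
    (hsa : ∀ x ∈ E, IsSelfAdjoint (D.T x))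
    (hbr : ∀ x ∈ E, ∀ d ∈ E, D.ad (D.T x) (D.ad (D.T x) d) ∈ E)
    (x : K) (hx : x ∈ E) (R : ℝ) :
    ∃ C : ℝ, 0 ≤ C ∧ ∀ z ∈ E, ‖D.T z‖ ≤ R → ∀ h : ℝ, 0 ≤ h → h ≤ 1 →
      ∃ z' ∈ E, ∃ w : K, D.T w = exp (h • D.T x) * exp (D.T z) * exp (h • D.T x) - exp (D.T z') ∧
        ‖w‖ ≤ C * h ^ 2 := by
  set A := Real.exp (3 * ‖x‖) * ‖x‖ ^ 2 with hA
  set N := Real.exp (4 * R) * (2 * (Real.exp R * Real.exp R * ‖x‖)) with hN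
  have hA0 : 0 ≤ A := by positivity
  have hN0 : 0 ≤ N := by positivity
  refine ⟨2 * (Real.exp R * A) + Real.exp R * (‖x‖ + A) ^ 2 + Real.exp (3 * (R + N)) * N ^ 2,
    by positivity, ?_⟩
  intro z hz hzR h h0 h1
  obtain ⟨ρ₂, a1, a2, a3⟩ := D.exp_small x h h0 h1
  rw [← hA] at a2 a3
  set p := exp (D.T z) with hp
  have hpn : ‖p‖ ≤ Real.exp R := (cnorm_exp_le _).trans (Real.exp_le_exp.2 hzR)
  set Z := D.T z with hZ
  have hW : ∃ W ∈ E, ‖W‖ ≤ 2 * (Real.exp R * Real.exp R * ‖x‖) ∧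
      D.T (D.L (exp ((1/2 : ℝ) • Z)) (D.R (exp ((1/2 : ℝ) • Z)) W)) = p * D.T x + D.T x * p := by
    refine ⟨_, D.cosh_mem E hE Z (hbr z hz) (1/2) x hx, ?_, ?_⟩
    · refine (norm_add_le _ _).trans ?_
      rw [two_mul]
      gcongr <;> refine (D.norm_LR _ _ _).trans ?_ <;> gcongr <;>
        exact norm_exp_smul_le _ _ _ (by rw [abs_le]; constructor <;> norm_num) hzR
    · simp only [map_add, D.T_L, D.T_R]
      have e1 : exp ((1/2 : ℝ) • Z) * exp ((1/2 : ℝ) • Z) = p := by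
        rw [gexp_smul_add]; norm_num; rfl
      have e2 : exp ((-(1/2) : ℝ) • Z) * exp ((1/2 : ℝ) • Z) = 1 := by
        rw [gexp_smul_add]; norm_num
      have e3 : exp ((1/2 : ℝ) • Z) * exp ((-(1/2) : ℝ) • Z) = 1 := by
        rw [gexp_smul_add]; norm_num
      generalize exp ((1/2 : ℝ) • Z) = u at *
      generalize exp ((-(1/2) : ℝ) • Z) = v at *
      calc _ = (u * u) * D.T x * (v * u) + (u * v) * D.T x * (u * u) := by noncomm_ring
        _ = _ := by rw [e1, e2, e3]; simp
  obtain ⟨W, hWE, hWn, hWT⟩ := hW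
  obtain ⟨v, hv, hSv, hvn⟩ := D.solve E hE Z (hsa z hz) (hbr z hz) R hzR (h • W) (E.smul_mem h hWE)
  have hvN : ‖v‖ ≤ h * N := by
    refine hvn.trans ?_
    rw [norm_smul, Real.norm_of_nonneg h0, hN]
    calc _ = h * (Real.exp (4 * R) * ‖W‖) := by ring
      _ ≤ _ := by gcongr
  obtain ⟨ρ₁, b1, b2⟩ := D.dexp Z v (R + N) (by linarith) (by
    refine (norm_add_le _ _).trans (add_le_add hzR ((D.norm_T v).trans (hvN.trans ?_)))
    nlinarith)
  refine ⟨z + v, E.add_mem hz hv, D.R p ρ₂ + D.L p ρ₂ +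
    D.L (D.T (h • x + ρ₂)) (D.L p (h • x + ρ₂)) - ρ₁, ?_, ?_⟩
  · rw [map_add D.T z v, b1, hSv, R_smul, L_smul, T_smul, hWT, a1]
    have ha : D.T (h • x + ρ₂) = h • D.T x + D.T ρ₂ := by rw [map_add, T_smul]
    generalize h • x + ρ₂ = a at *
    simp only [map_add, map_sub, D.T_L, D.T_R, ← hp]
    rw [ha]
    generalize D.T ρ₁ = r1
    generalize D.T ρ₂ = r2
    simp only [add_mul, mul_add, one_mul, mul_one, smul_mul_assoc, mul_smul_comm, smul_add,
      mul_assoc]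
    abel
  · refine (norm_sub_le _ _).trans ?_
    have c1 : ‖D.R p ρ₂ + D.L p ρ₂ + D.L (D.T (h • x + ρ₂)) (D.L p (h • x + ρ₂))‖ ≤
        Real.exp R * (h ^ 2 * A) + Real.exp R * (h ^ 2 * A) +
          (h * (‖x‖ + A)) * (Real.exp R * (h * (‖x‖ + A))) := by
      refine (norm_add_le _ _).trans (add_le_add ((norm_add_le _ _).trans (add_le_add ?_ ?_)) ?_)
      · refine (D.norm_R _ _).trans ?_
        gcongr
      · refine (D.norm_L _ _).trans ?_
        gcongr
      · refine (D.norm_L _ _).trans ?_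
        gcongr
        · exact (D.norm_T _).trans a3
        · refine (D.norm_L _ _).trans ?_
          gcongr
    have c2 : ‖ρ₁‖ ≤ Real.exp (3 * (R + N)) * (h * N) ^ 2 := b2.trans (by gcongr)
    calc _ ≤ _ := add_le_add c1 c2
      _ = _ := by ring

theorem op_bound (X Y z : B) (hz : IsSelfAdjoint z) (t : ℝ) (ht : |t| ≤ 1)
    (h : ‖exp ((-t) • X) * exp z * exp ((-t) • X) - exp Y‖ ≤ Real.exp (-‖Y‖) / 2) :
    ‖z‖ ≤ Real.exp ‖X‖ * (Real.exp ‖Y‖ + Real.exp (-‖Y‖) / 2) * Real.exp ‖X‖ +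
      Real.exp ‖X‖ * (2 * Real.exp ‖Y‖) * Real.exp ‖X‖ := by
  refine (norm_le_exp_add z hz).trans ?_
  have ht' : |-t| ≤ 1 := by rwa [abs_neg]
  have n1 : ‖exp (t • X)‖ ≤ Real.exp ‖X‖ := norm_exp_smul_le X t _ ht le_rfl
  have n2 : ‖exp ((-t) • X)‖ ≤ Real.exp ‖X‖ := norm_exp_smul_le X (-t) _ ht' le_rfl
  have nY : ‖exp Y‖ ≤ Real.exp ‖Y‖ := cnorm_exp_le Y
  have nY' : ‖exp (-Y)‖ ≤ Real.exp ‖Y‖ := by simpa using cnorm_exp_le (-Y)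
  have e1 : exp (t • X) * exp ((-t) • X) = 1 := by rw [gexp_smul_add]; simp
  have e2 : exp ((-t) • X) * exp (t • X) = 1 := by rw [gexp_smul_add]; simp
  have ez1 := gexp_mul_neg z
  have ez2 := gexp_neg_mul z
  have eY1 := gexp_mul_neg Y
  generalize exp (t • X) = u at *
  generalize exp ((-t) • X) = v at *
  generalize exp z = q at *
  generalize exp (-z) = q' at *
  generalize exp Y = y at *
  generalize exp (-Y) = y' at *
  have k1 : q = u * (v * q * v) * u := by
    calc q = (u * v) * q * (v * u) := by rw [e1, e2]; simp
      _ = _ := by noncomm_ring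
  have k2 : q' = v * (u * q' * u) * v := by
    calc q' = (v * u) * q' * (u * v) := by rw [e1, e2]; simp
      _ = _ := by noncomm_ring
  have k3 : (u * q' * u) * (v * q * v) = 1 := by
    calc _ = u * (q' * (u * v) * q) * v := by noncomm_ring
      _ = 1 := by rw [e1, mul_one, ez2, mul_one, e1]
  set g := v * q * v with hg
  set g' := u * q' * u with hg'
  have k4 : g' = y' - g' * (g - y) * y' := by
    calc g' = g' * (y * y') := by rw [eY1, mul_one]
      _ = (g' * g) * y' - g' * (g - y) * y' := by noncomm_ring
      _ = _ := by rw [k3, one_mul]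
  have hgn : ‖g‖ ≤ Real.exp ‖Y‖ + Real.exp (-‖Y‖) / 2 := by
    calc ‖g‖ = ‖y + (g - y)‖ := by congr 1; abel
      _ ≤ _ := (norm_add_le _ _).trans (add_le_add nY h)
  have hgn' : ‖g'‖ ≤ 2 * Real.exp ‖Y‖ := by
    have : ‖g'‖ ≤ Real.exp ‖Y‖ + ‖g'‖ * (Real.exp (-‖Y‖) / 2) * Real.exp ‖Y‖ := by
      conv_lhs => rw [k4]
      refine (norm_sub_le _ _).trans (add_le_add nY' ?_)
      refine (norm_mul_le _ _).trans ?_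
      gcongr
      refine (norm_mul_le _ _).trans ?_
      gcongr
    have e : Real.exp (-‖Y‖) * Real.exp ‖Y‖ = 1 := by rw [← Real.exp_add]; simp
    have : ‖g'‖ * (Real.exp (-‖Y‖) / 2) * Real.exp ‖Y‖ = ‖g'‖ / 2 := by
      calc _ = ‖g'‖ / 2 * (Real.exp (-‖Y‖) * Real.exp ‖Y‖) := by ring
        _ = _ := by rw [e, mul_one]
    linarith
  refine add_le_add ?_ ?_
  · rw [k1]
    refine (norm_mul_le _ _).trans ?_
    gcongr
    refine (norm_mul_le _ _).trans ?_
    gcongr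
  · rw [k2]
    refine (norm_mul_le _ _).trans ?_
    gcongr
    refine (norm_mul_le _ _).trans ?_
    gcongr

theorem euler (E : Submodule ℝ K) (hE : IsClosed (E : Set K))
    (hsa : ∀ x ∈ E, IsSelfAdjoint (D.T x))
    (hbr : ∀ x ∈ E, ∀ d ∈ E, D.ad (D.T x) (D.ad (D.T x) d) ∈ E)
    (x : K) (hx : x ∈ E) (y : K) (hy : y ∈ E) :
    ∃ R : ℝ, ∀ ε > 0, ∃ z ∈ E, ‖D.T z‖ ≤ R ∧ ∃ w : K, ‖w‖ ≤ ε ∧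
      D.T w = exp (D.T z) - exp (D.T x) * exp (D.T y) * exp (D.T x) := by
  set X := D.T x with hX
  set Y := D.T y with hY
  set R := Real.exp ‖X‖ * (Real.exp ‖Y‖ + Real.exp (-‖Y‖) / 2) * Real.exp ‖X‖ +
      Real.exp ‖X‖ * (2 * Real.exp ‖Y‖) * Real.exp ‖X‖ with hR
  refine ⟨R, fun ε hε => ?_⟩
  obtain ⟨C, hC, hstep⟩ := D.step E hE hsa hbr x hx R
  rw [← hX] at hstep
  set Q := Real.exp ‖X‖ * Real.exp ‖X‖ with hQ
  have hQ0 : 0 < Q := by positivity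
  have hc : 0 < min (Real.exp (-‖Y‖) / 2) (ε / Q) := by positivity
  obtain ⟨n, hn⟩ := exists_nat_gt (Q * C / min (Real.exp (-‖Y‖) / 2) (ε / Q))
  have hn0 : (0:ℝ) < n := lt_of_le_of_lt (by positivity) hn
  have hn1 : (1:ℝ) ≤ n := by
    have : 0 < n := by exact_mod_cast hn0
    exact_mod_cast this
  have hnC : Q * C / n ≤ min (Real.exp (-‖Y‖) / 2) (ε / Q) := by
    rw [div_le_iff₀ hn0]
    rw [div_lt_iff₀ hc] at hn
    linarith
  have main : ∀ k : ℕ, k ≤ n → ∃ z ∈ E, ∃ w : K,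
      D.T w = exp ((-(k / n : ℝ)) • X) * exp (D.T z) * exp ((-(k / n : ℝ)) • X) - exp Y ∧
      ‖w‖ ≤ Q * C * (k / n ^ 2) := by
    intro k
    induction k with
    | zero => intro _; exact ⟨y, hy, 0, by simp [hY], by simp⟩
    | succ k ih =>
      intro hk
      obtain ⟨z, hz, w, h1, h2⟩ := ih (by omega)
      have hk' : (k : ℝ) + 1 ≤ n := by exact_mod_cast hk
      have hkn : (k / n : ℝ) ≤ 1 := by rw [div_le_one hn0]; linarith
      have hkn0 : (0 : ℝ) ≤ k / n := by positivity
      have hwn : ‖w‖ ≤ Real.exp (-‖Y‖) / 2 := by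
        refine h2.trans (le_trans ?_ (hnC.trans (min_le_left _ _)))
        calc Q * C * (k / n ^ 2) = Q * C / n * (k / n) := by field_simp
          _ ≤ Q * C / n * 1 := by gcongr
          _ = _ := mul_one _
      have hzR : ‖D.T z‖ ≤ R := by
        apply op_bound X Y (D.T z) (hsa z hz) (k / n)
        · rw [abs_of_nonneg hkn0]; exact hkn
        · rw [← h1]; exact (D.norm_T w).trans hwn
      obtain ⟨z', hz', w', h3, h4⟩ := hstep z hz hzR (1 / n) (by positivity)
        (by rw [div_le_one hn0]; exact hn1)
      set t : ℝ := ((k + 1 : ℕ) : ℝ) / n with ht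
      have ht1 : |-t| ≤ 1 := by
        rw [abs_neg, abs_of_nonneg (by positivity), ht, div_le_one hn0]; exact_mod_cast hk
      refine ⟨z', hz', w - D.L (exp ((-t) • X)) (D.R (exp ((-t) • X)) w'), ?_, ?_⟩
      · rw [map_sub, D.T_L, D.T_R, h1, h3]
        have e1 : exp ((-t) • X) * exp ((1 / n : ℝ) • X) = exp ((-(k / n : ℝ)) • X) := by
          rw [gexp_smul_add]; congr 2; rw [ht]; push_cast; field_simp; ring
        have e2 : exp ((1 / n : ℝ) • X) * exp ((-t) • X) = exp ((-(k / n : ℝ)) • X) := by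
          rw [gexp_smul_add]; congr 2; rw [ht]; push_cast; field_simp; ring
        nth_rewrite 1 [← e1]
        rw [← e2]
        noncomm_ring
      · refine (norm_sub_le _ _).trans ?_
        have : ‖D.L (exp ((-t) • X)) (D.R (exp ((-t) • X)) w')‖ ≤ Q * (C * (1 / n) ^ 2) := by
          refine (D.norm_LR _ _ _).trans ?_
          rw [hQ]
          gcongr
          · exact norm_exp_smul_le X (-t) _ ht1 le_rfl
          · exact norm_exp_smul_le X (-t) _ ht1 le_rfl
        calc _ ≤ _ := add_le_add h2 this
          _ = _ := by push_cast; field_simp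
  obtain ⟨z, hz, w, h1, h2⟩ := main n le_rfl
  have hnn : (n / n : ℝ) = 1 := div_self hn0.ne'
  have h2' : ‖w‖ ≤ Q * C / n := by
    refine h2.trans (le_of_eq ?_)
    field_simp
  rw [hnn] at h1
  refine ⟨z, hz, ?_, D.L (exp X) (D.R (exp X) w), ?_, ?_⟩
  · apply op_bound X Y (D.T z) (hsa z hz) 1 (by simp)
    rw [← h1]
    exact (D.norm_T w).trans (h2'.trans (hnC.trans (min_le_left _ _)))
  · refine (D.norm_LR _ _ _).trans ?_
    have nX : ‖exp X‖ ≤ Real.exp ‖X‖ := cnorm_exp_le X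
    calc ‖exp X‖ * ‖exp X‖ * ‖w‖ ≤ Q * (ε / Q) := by
          gcongr
          · rw [hQ]; gcongr
          · exact h2'.trans (hnC.trans (min_le_right _ _))
      _ = ε := by field_simp
  · rw [D.T_L, D.T_R, h1]
    have e1 := gexp_mul_neg X
    have e2 := gexp_neg_mul X
    rw [neg_smul, one_smul]
    calc _ = (exp X * exp (-X)) * exp (D.T z) * (exp (-X) * exp X) - exp X * exp Y * exp X := by
          noncomm_ring
      _ = _ := by rw [e1, e2]; simp

theorem forward (E : Submodule ℝ K) (hE : IsClosed (E : Set K))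
    (hsa : ∀ x ∈ E, IsSelfAdjoint (D.T x))
    (hbr : ∀ x ∈ E, ∀ d ∈ E, D.ad (D.T x) (D.ad (D.T x) d) ∈ E)
    (x : K) (hx : x ∈ E) (y : K) (hy : y ∈ E) :
    ∃ z ∈ E, exp (D.T z) = exp (D.T x) * exp (D.T y) * exp (D.T x) := by
  obtain ⟨R, hR⟩ := D.euler E hE hsa hbr x hx y hy
  choose z hz hzR w hw hTw using fun n : ℕ => hR (1 / ((n : ℝ) + 1)) (by positivity)
  have hlim : Tendsto (fun n : ℕ => 1 / ((n : ℝ) + 1)) atTop (𝓝 0) :=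
    tendsto_one_div_add_atTop_nhds_zero_nat
  have hmono : ∀ N n : ℕ, N ≤ n → ‖w n‖ ≤ 1 / ((N : ℝ) + 1) := by
    intro N n h
    refine (hw n).trans ?_
    gcongr
  have hc : CauchySeq z := by
    apply cauchySeq_of_le_tendsto_0 (fun N : ℕ => Real.exp (4 * R) * (2 * (1 / ((N : ℝ) + 1))))
    · intro n m N hn hm
      rw [dist_eq_norm]
      refine (D.log_lip (z n) (z m) (w n - w m) (hsa _ (hz n)) (hsa _ (hz m)) R (hzR n) (hzR m)
        ?_).trans ?_
      · rw [map_sub, hTw, hTw]; abel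
      · gcongr
        refine (norm_sub_le _ _).trans ?_
        rw [two_mul]
        exact add_le_add (hmono N n hn) (hmono N m hm)
    · simpa using (hlim.const_mul 2).const_mul (Real.exp (4 * R))
  obtain ⟨Z, hZ⟩ := cauchySeq_tendsto_of_complete hc
  refine ⟨Z, hE.mem_of_tendsto hZ (Eventually.of_forall hz), ?_⟩
  have l1 : Tendsto (fun n => exp (D.T (z n))) atTop (𝓝 (exp (D.T Z))) :=
    ((gexp_cont.comp D.T.continuous).tendsto Z).comp hZ
  have l2 : Tendsto w atTop (𝓝 0) := squeeze_zero_norm hw hlim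
  have l3 : Tendsto (fun n => D.T (w n) + exp (D.T x) * exp (D.T y) * exp (D.T x)) atTop
      (𝓝 (0 + exp (D.T x) * exp (D.T y) * exp (D.T x))) := by
    have := (D.T.continuous.tendsto 0).comp l2
    rw [map_zero] at this
    exact this.add_const _
  rw [zero_add] at l3
  refine tendsto_nhds_unique l1 (l3.congr fun n => ?_)
  rw [hTw]; abel

end HSData

namespace HSData
variable {B K : Type*} [CStarAlgebra B] [NormedAddCommGroup K] [InnerProductSpace ℂ K]
  [CompleteSpace K] (D : HSData B K)

set_option maxHeartbeats 1000000 in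
theorem back_curve (E : Submodule ℝ K)
    (hsa : ∀ x ∈ E, IsSelfAdjoint (D.T x))
    (hex : ∀ x ∈ E, ∀ y ∈ E, ∃ z ∈ E, exp (D.T z) = exp (D.T x) * exp (D.T y) * exp (D.T x))
    (x : K) (hx : x ∈ E) (y : K) (hy : y ∈ E) (t : ℝ) :
    ∃ C : ℝ, ∀ s : ℝ, 0 ≤ s → s ≤ 1 → ∃ z ∈ E,
      ‖z - s • (D.L (exp ((-t) • D.T x)) (D.R (exp (t • D.T x)) y) +
        D.L (exp (t • D.T x)) (D.R (exp ((-t) • D.T x)) y))‖ ≤ C * s ^ 2 := by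
  set u := exp (t • D.T x) with hu
  set v := exp ((-t) • D.T x) with hv
  set M := ‖u‖ + ‖v‖ with hM
  have hM0 : 0 ≤ M := by positivity
  have huM : ‖u‖ ≤ M := by rw [hM]; linarith [norm_nonneg v]
  have hvM : ‖v‖ ≤ M := by rw [hM]; linarith [norm_nonneg u]
  have uv : u * v = 1 := by rw [hu, hv, gexp_smul_add]; simp
  have vu : v * u = 1 := by rw [hu, hv, gexp_smul_add]; simp
  set A := Real.exp (3 * ‖y‖) * ‖y‖ ^ 2 with hA
  have hA0 : 0 ≤ A := by positivity
  set Ey := Real.exp ‖D.T y‖ with hEy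
  set r := 2 * (M * Ey * (M * M) * Ey * M) with hr
  have hr0 : 0 ≤ r := by positivity
  set b := ‖y‖ + A with hb
  have hb0 : 0 ≤ b := by positivity
  set Q1 := M * (b * ((M * M) * M * b)) with hQ1
  have hQ10 : 0 ≤ Q1 := by positivity
  set G := Real.exp (4 * r) * (2 * (M * M * b) + Q1) with hG
  have hG0 : 0 ≤ G := by positivity
  refine ⟨2 * (M * M * A) + Q1 + Real.exp (3 * G) * G ^ 2, fun s s0 s1 => ?_⟩
  obtain ⟨ρ, a1, a2, a3⟩ := D.exp_small y s s0 s1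
  rw [← hA] at a2 a3
  obtain ⟨z1, hz1, e1⟩ := hex (s • y) (E.smul_mem s hy) ((2 * t) • x) (E.smul_mem _ hx)
  obtain ⟨z, hz, e2⟩ := hex ((-t) • x) (E.smul_mem _ hx) z1 hz1
  rw [e1] at e2
  simp only [T_smul] at e2
  have u2 : exp ((2 * t) • D.T x) = u * u := by rw [hu, gexp_smul_add]; congr 2; ring
  rw [u2, ← hv] at e2
  have sn : |s| ≤ 1 := by rw [abs_of_nonneg s0]; exact s1
  have nq : ‖exp (s • D.T y)‖ ≤ Ey := norm_exp_smul_le _ _ _ sn le_rfl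
  have nq' : ‖exp ((-s) • D.T y)‖ ≤ Ey := norm_exp_smul_le _ _ _ (by rwa [abs_neg]) le_rfl
  have qq' : exp (s • D.T y) * exp ((-s) • D.T y) = 1 := by rw [gexp_smul_add]; simp
  have hzr : ‖D.T z‖ ≤ r := by
    refine (norm_le_exp_add _ (hsa z hz)).trans ?_
    have f1 : exp (-D.T z) = u * exp ((-s) • D.T y) * (v * v) * exp ((-s) • D.T y) * u := by
      have h1 : exp (D.T z) * (u * exp ((-s) • D.T y) * (v * v) * exp ((-s) • D.T y) * u) = 1 := by
        rw [e2]
        generalize exp (s • D.T y) = q at *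
        generalize exp ((-s) • D.T y) = q' at *
        calc _ = v * q * (u * u) * q * (v * u) * q' * (v * v) * q' * u := by noncomm_ring
          _ = v * q * (u * u) * (q * q') * (v * v) * q' * u := by rw [vu]; noncomm_ring
          _ = v * q * u * (u * v) * v * q' * u := by rw [qq']; noncomm_ring
          _ = v * q * u * v * q' * u := by rw [uv, mul_one]
          _ = v * q * (u * v) * q' * u := by noncomm_ring
          _ = v * (q * q') * u := by rw [uv, mul_one, mul_assoc v q q']
          _ = 1 := by rw [qq', mul_one, vu]
      calc exp (-D.T z) = exp (-D.T z) * (exp (D.T z) *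
            (u * exp ((-s) • D.T y) * (v * v) * exp ((-s) • D.T y) * u)) := by rw [h1, mul_one]
        _ = _ := by rw [← mul_assoc, gexp_neg_mul, one_mul]
    have f2 : ∀ p q w : B, ‖p‖ ≤ M → ‖w‖ ≤ M → ‖q‖ ≤ Ey →
        ‖p * q * (w * w) * q * p‖ ≤ M * Ey * (M * M) * Ey * M := by
      intro p q w hp hw hq
      refine (norm_mul_le _ _).trans ?_
      gcongr
      refine (norm_mul_le _ _).trans ?_
      gcongr
      refine (norm_mul_le _ _).trans ?_
      gcongr
      · refine (norm_mul_le _ _).trans ?_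
        gcongr
      · refine (norm_mul_le _ _).trans ?_
        gcongr
    rw [f1, e2, hr, two_mul]
    refine add_le_add ?_ (f2 u _ v huM hvM nq')
    have := f2 v _ u hvM huM nq
    simp only [mul_assoc] at this ⊢
    exact this
  set a := s • y + ρ with ha
  set P : K → K := fun k => D.L v (D.R u k) + D.L u (D.R v k) with hP
  have nP : ∀ k, ‖P k‖ ≤ 2 * (M * M * ‖k‖) := by
    intro k
    refine (norm_add_le _ _).trans ?_
    rw [two_mul]
    gcongr <;> refine (D.norm_LR _ _ _).trans ?_ <;> gcongr
  set Q := D.L v (D.L (D.T a) (D.L (u * u) (D.R v a))) with hQ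
  have nQ : ‖Q‖ ≤ Q1 * s ^ 2 := by
    calc ‖Q‖ ≤ M * ((s * b) * ((M * M) * (M * (s * b)))) := by
          refine (D.norm_L _ _).trans ?_
          gcongr
          refine (D.norm_L _ _).trans ?_
          gcongr
          · exact (D.norm_T _).trans a3
          refine (D.norm_L _ _).trans ?_
          gcongr
          · refine (norm_mul_le _ _).trans ?_
            gcongr
          refine (D.norm_R _ _).trans ?_
          gcongr
      _ = _ := by rw [hQ1]; ring
  have hTz : exp (D.T z) = 1 + D.T (P a + Q) := by
    rw [e2, a1]
    simp only [hP, hQ, map_add, D.T_L, D.T_R]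
    generalize D.T a = α
    calc _ = v * u * (u * v) + v * α * u * (u * v) + (v * u) * u * α * v + v * α * u * u * α * v := by
          noncomm_ring
      _ = _ := by rw [uv, vu]; noncomm_ring
  have nw : ‖P a + Q‖ ≤ (2 * (M * M * b) + Q1) * s := by
    have h1 := nP a
    have h2 : 2 * (M * M * ‖a‖) ≤ 2 * (M * M * (s * b)) := by gcongr
    have hss : s ^ 2 ≤ s := by
      rw [pow_two]; exact mul_le_of_le_one_left s0 s1
    have h3 : Q1 * s ^ 2 ≤ Q1 * s := mul_le_mul_of_nonneg_left hss hQ10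
    calc _ ≤ ‖P a‖ + ‖Q‖ := norm_add_le _ _
      _ ≤ 2 * (M * M * (s * b)) + Q1 * s := add_le_add (h1.trans h2) (nQ.trans h3)
      _ = _ := by ring
  have hzs : ‖z‖ ≤ G * s := by
    have := D.log_lip z 0 (P a + Q) (hsa z hz) (by simp) r hzr (by simpa using hr0)
      (by rw [hTz]; simp)
    rw [sub_zero] at this
    refine this.trans ?_
    rw [hG, mul_assoc]
    gcongr
  have hzG : ‖z‖ ≤ G := hzs.trans (mul_le_of_le_one_right hG0 s1)
  obtain ⟨ρ', c1, c2⟩ := D.exp_one z G hzG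
  have hzeq : z = P a + Q - ρ' := by
    apply D.T_inj
    rw [map_sub, eq_sub_iff_add_eq]
    rw [hTz, add_assoc 1 (D.T z)] at c1
    exact (add_left_cancel c1).symm
  refine ⟨z, hz, ?_⟩
  have hfin : z - s • P y = P ρ + Q - ρ' := by
    have : P a = s • P y + P ρ := by
      simp only [hP, ha, map_add, R_smul, L_smul, smul_add]; abel
    rw [hzeq, this]; abel
  change ‖z - s • P y‖ ≤ _
  rw [hfin]
  have hP2 : ‖P ρ‖ ≤ 2 * (M * M * (s ^ 2 * A)) := (nP ρ).trans (by gcongr)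
  have hρ' : ‖ρ'‖ ≤ Real.exp (3 * G) * (G * s) ^ 2 := c2.trans (by gcongr)
  calc _ ≤ ‖P ρ + Q‖ + ‖ρ'‖ := norm_sub_le _ _
    _ ≤ (‖P ρ‖ + ‖Q‖) + ‖ρ'‖ := by gcongr; exact norm_add_le _ _
    _ ≤ _ := add_le_add (add_le_add hP2 nQ) hρ'
    _ = _ := by ring

theorem back_W (E : Submodule ℝ K) (hE : IsClosed (E : Set K))
    (hsa : ∀ x ∈ E, IsSelfAdjoint (D.T x))
    (hex : ∀ x ∈ E, ∀ y ∈ E, ∃ z ∈ E, exp (D.T z) = exp (D.T x) * exp (D.T y) * exp (D.T x))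
    (x : K) (hx : x ∈ E) (y : K) (hy : y ∈ E) (t : ℝ) :
      D.L (exp ((-t) • D.T x)) (D.R (exp (t • D.T x)) y) +
        D.L (exp (t • D.T x)) (D.R (exp ((-t) • D.T x)) y) ∈ E := by
  obtain ⟨C, hC⟩ := D.back_curve E hsa hex x hx y hy t
  generalize D.L (exp ((-t) • D.T x)) (D.R (exp (t • D.T x)) y) +
        D.L (exp (t • D.T x)) (D.R (exp ((-t) • D.T x)) y) = W at *
  choose z hz hzn using fun n : ℕ => hC (1 / ((n : ℝ) + 1)) (by positivity) (by
    rw [div_le_one (by positivity)]; linarith [n.cast_nonneg (α := ℝ)])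
  have hlim : Tendsto (fun n : ℕ => 1 / ((n : ℝ) + 1)) atTop (𝓝 0) :=
    tendsto_one_div_add_atTop_nhds_zero_nat
  have h1 : Tendsto (fun n : ℕ => ((n : ℝ) + 1) • z n) atTop (𝓝 W) := by
    rw [tendsto_iff_norm_sub_tendsto_zero]
    refine squeeze_zero (fun _ => norm_nonneg _) (fun n => ?_) (by simpa using hlim.const_mul C)
    have hn : (0:ℝ) < (n:ℝ) + 1 := by positivity
    have : ((n : ℝ) + 1) • z n - W = ((n : ℝ) + 1) • (z n - (1 / ((n : ℝ) + 1)) • W) := by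
      rw [smul_sub, smul_smul, mul_one_div_cancel hn.ne', one_smul]
    rw [this, norm_smul, Real.norm_of_nonneg hn.le]
    calc _ ≤ ((n : ℝ) + 1) * (C * (1 / ((n : ℝ) + 1)) ^ 2) := by gcongr; exact hzn n
      _ = _ := by field_simp
  exact hE.mem_of_tendsto h1 (Eventually.of_forall fun n => E.smul_mem _ (hz n))

theorem deriv_mem (E : Submodule ℝ K) (hE : IsClosed (E : Set K)) (f : ℝ → K) (f' : K) (t : ℝ)
    (hf : ∀ s, f s ∈ E) (h : HasDerivAt f f' t) : f' ∈ E := by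
  rw [hasDerivAt_iff_tendsto_slope] at h
  refine hE.mem_of_tendsto h (Eventually.of_forall fun s => ?_)
  rw [slope_def_module]
  exact E.smul_mem _ (E.sub_mem (hf _) (hf _))

theorem backward (E : Submodule ℝ K) (hE : IsClosed (E : Set K))
    (hsa : ∀ x ∈ E, IsSelfAdjoint (D.T x))
    (hex : ∀ x ∈ E, ∀ y ∈ E, ∃ z ∈ E, exp (D.T z) = exp (D.T x) * exp (D.T y) * exp (D.T x))
    (x : K) (hx : x ∈ E) (y : K) (hy : y ∈ E) :
    D.ad (D.T x) (D.ad (D.T x) y) ∈ E := by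
  set A := D.ad (D.T x) with hA
  have e : ∀ t : ℝ, D.L (exp (t • D.T x)) (D.R (exp ((-t) • D.T x)) y) = exp (t • A) y := by
    intro t
    have : t • D.ad (D.T x) = D.ad (t • D.T x) := by rw [ad_smul, Complex.coe_smul]
    rw [hA, this, exp_ad, neg_smul]
  have hW : ∀ t : ℝ, exp (t • A) y + exp ((-t) • A) y ∈ E := by
    intro t
    have := D.back_W E hE hsa hex x hx y hy (-t)
    rw [neg_neg] at this
    have h2 := e (-t)
    rw [neg_neg] at h2
    rw [h2, e t] at this
    exact this
  have d1 : ∀ (k : K) (t : ℝ), HasDerivAt (fun t : ℝ => exp (t • A) k) (exp (t • A) (A k)) t := by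
    intro k t
    have := hasDerivAt_exp_smul_const (𝕂 := ℝ) A t
    exact (((ContinuousLinearMap.apply ℂ K k).restrictScalars ℝ).hasFDerivAt.comp_hasDerivAt t this)
  have d2 : ∀ (k : K) (t : ℝ), HasDerivAt (fun t : ℝ => exp ((-t) • A) k)
      (-exp ((-t) • A) (A k)) t := by
    intro k t
    have := (d1 k (-t)).scomp t (hasDerivAt_neg t)
    simpa [Function.comp_def] using this
  have h1 : ∀ t : ℝ, exp (t • A) (A y) - exp ((-t) • A) (A y) ∈ E := by
    intro t
    refine deriv_mem E hE _ _ t hW ?_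
    rw [sub_eq_add_neg]
    exact (d1 y t).add (d2 y t)
  have h2 := deriv_mem E hE _ _ 0 h1 ((d1 (A y) 0).sub (d2 (A y) 0))
  simp only [zero_smul, neg_zero, exp_zero, one_apply_eq_self, sub_neg_eq_add] at h2
  have h3 := E.smul_mem (1/2 : ℝ) h2
  rw [← two_smul ℝ (A (A y)), smul_smul] at h3
  simpa using h3

end HSData

section Concrete

theorem lp_hasSum_sq {G : Type*} [NormedAddCommGroup G] (x : lp (fun _ : ι => G) 2) :
    HasSum (fun i => ‖x i‖ ^ 2) (‖x‖ ^ 2) := by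
  have := lp.hasSum_norm (p := 2) (by norm_num) x
  simpa using this

def HSsp (ι H : Type*) [NormedAddCommGroup H] : Type _ := lp (fun _ : ι => H) 2

instance (ι H : Type*) [NormedAddCommGroup H] : NormedAddCommGroup (HSsp ι H) :=
  inferInstanceAs (NormedAddCommGroup (lp (fun _ : ι => H) 2))

instance (ι H : Type*) [NormedAddCommGroup H] [InnerProductSpace ℂ H] :
    InnerProductSpace ℂ (HSsp ι H) :=
  inferInstanceAs (InnerProductSpace ℂ (lp (fun _ : ι => H) 2))

instance (ι H : Type*) [NormedAddCommGroup H] [CompleteSpace H] :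
    CompleteSpace (HSsp ι H) :=
  inferInstanceAs (CompleteSpace (lp (fun _ : ι => H) 2))

namespace HSsp

def co (x : HSsp ι H) (i : ι) : H := (show lp (fun _ : ι => H) 2 from x) i

theorem co_add (x y : HSsp ι H) (i : ι) : (x + y).co i = x.co i + y.co i := rfl
theorem co_smul (c : ℂ) (y : HSsp ι H) (i : ι) : (c • y).co i = c • y.co i := rfl

theorem hasSum_co (x : HSsp ι H) : HasSum (fun i => ‖x.co i‖ ^ 2) (‖x‖ ^ 2) :=
  lp_hasSum_sq (show lp (fun _ : ι => H) 2 from x)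

theorem hasSum_inner (x y : HSsp ι H) :
    HasSum (fun i => (inner ℂ (x.co i) (y.co i) : ℂ)) (inner ℂ x y) :=
  lp.hasSum_inner (show lp (fun _ : ι => H) 2 from x) (show lp (fun _ : ι => H) 2 from y)

theorem ext_co {x y : HSsp ι H} (h : ∀ i, x.co i = y.co i) : x = y :=
  lp.ext (funext h)

def ofFun (f : ι → H) (h : Summable fun i => ‖f i‖ ^ 2) : HSsp ι H :=
  (⟨f, (memℓp_gen_iff (p := 2) (by norm_num)).2 (by simpa using h)⟩ : lp (fun _ : ι => H) 2)

theorem co_ofFun (f : ι → H) (h : Summable fun i => ‖f i‖ ^ 2) (i : ι) :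
    (ofFun f h).co i = f i := rfl

end HSsp

variable (e : HilbertBasis ι ℂ H)

theorem parseval (v : H) : HasSum (fun i => ‖e.repr v i‖ ^ 2) (‖v‖ ^ 2) := by
  have := lp_hasSum_sq (e.repr v)
  rwa [LinearIsometryEquiv.norm_map] at this

theorem basis_ext {A C : H →L[ℂ] H} (h : ∀ i, A (e i) = C (e i)) : A = C := by
  apply ContinuousLinearMap.ext_on (s := Set.range e)
  · rw [Submodule.dense_iff_topologicalClosure_eq_top]; exact e.dense_span
  · rintro _ ⟨i, rfl⟩; exact h i

theorem toOp_summable (x : HSsp ι H) (v : H) : Summable fun i => e.repr v i • x.co i := by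
  refine Summable.of_norm_bounded ((parseval e v).summable.add x.hasSum_co.summable) fun i => ?_
  rw [norm_smul]
  nlinarith [sq_nonneg (‖e.repr v i‖ - ‖x.co i‖), sq_nonneg (‖e.repr v i‖ + ‖x.co i‖)]

theorem toOp_bound (x : HSsp ι H) (v : H) : ‖∑' i, e.repr v i • x.co i‖ ≤ ‖x‖ * ‖v‖ := by
  have h := (toOp_summable e x v).hasSum.norm
  refine le_of_tendsto h (Eventually.of_forall fun s => ?_)
  calc ‖∑ i ∈ s, e.repr v i • x.co i‖ ≤ ∑ i ∈ s, ‖x.co i‖ * ‖e.repr v i‖ := by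
        refine (norm_sum_le _ _).trans (le_of_eq (Finset.sum_congr rfl fun i _ => ?_))
        rw [norm_smul, mul_comm]
    _ ≤ √(∑ i ∈ s, ‖x.co i‖ ^ 2) * √(∑ i ∈ s, ‖e.repr v i‖ ^ 2) :=
        Real.sum_mul_le_sqrt_mul_sqrt _ _ _
    _ ≤ √(‖x‖ ^ 2) * √(‖v‖ ^ 2) := by
        gcongr
        · exact sum_le_hasSum s (fun i _ => by positivity) x.hasSum_co
        · exact sum_le_hasSum s (fun i _ => by positivity) (parseval e v)
    _ = _ := by rw [Real.sqrt_sq (norm_nonneg _), Real.sqrt_sq (norm_nonneg _)]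

def toOp : HSsp ι H →L[ℂ] (H →L[ℂ] H) :=
  LinearMap.mkContinuous₂ (LinearMap.mk₂ ℂ (fun (x : HSsp ι H) v => ∑' i, e.repr v i • x.co i)
    (fun x y v => by
      rw [← (toOp_summable e x v).tsum_add (toOp_summable e y v)]
      simp only [HSsp.co_add, smul_add])
    (fun c x v => by
      rw [← (toOp_summable e x v).tsum_const_smul c]
      exact tsum_congr fun i => by rw [HSsp.co_smul, smul_comm])
    (fun x v w => by
      rw [← (toOp_summable e x v).tsum_add (toOp_summable e x w)]
      simp [add_smul])
    (fun c x v => by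
      rw [← (toOp_summable e x v).tsum_const_smul c]
      simp [smul_smul])) 1 (fun x v => by
        rw [one_mul]; exact toOp_bound e x v)

theorem toOp_apply (x : HSsp ι H) (v : H) : toOp e x v = ∑' i, e.repr v i • x.co i := rfl

theorem norm_toOp (x : HSsp ι H) : ‖toOp e x‖ ≤ ‖x‖ :=
  ContinuousLinearMap.opNorm_le_bound _ (norm_nonneg _) fun v => toOp_bound e x v

theorem toOp_basis (x : HSsp ι H) (i : ι) : toOp e x (e i) = x.co i := by
  classical
  rw [toOp_apply, tsum_eq_single i]
  · simp [HilbertBasis.repr_self]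
  · intro j hj
    simp [HilbertBasis.repr_self, lp.single_apply, hj]

theorem toOp_inj : Function.Injective (toOp e : HSsp ι H → (H →L[ℂ] H)) := by
  intro x y h
  apply HSsp.ext_co
  intro i
  rw [← toOp_basis e, ← toOp_basis e, h]

theorem toOp_hs (x : HSsp ι H) : IsHS e (toOp e x) := by
  simp only [IsHS, toOp_basis]
  exact x.hasSum_co.summable

def mkHS (A : H →L[ℂ] H) (h : IsHS e A) : HSsp ι H := HSsp.ofFun (fun i => A (e i)) h

theorem toOp_mk (A : H →L[ℂ] H) (h : IsHS e A) : toOp e (mkHS e A h) = A := by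
  apply basis_ext e
  intro i
  rw [toOp_basis]; rfl

theorem hsNorm_toOp (x : HSsp ι H) : hsNorm e (toOp e x) = ‖x‖ := by
  simp only [hsNorm, toOp_basis]
  rw [x.hasSum_co.tsum_eq, Real.sqrt_sq (norm_nonneg _)]

/-- squared Hilbert-Schmidt norm, extended-real valued -/
def hs2 (A : H →L[ℂ] H) : ENNReal := ∑' i, ENNReal.ofReal (‖A (e i)‖ ^ 2)

theorem hs2_toOp (x : HSsp ι H) : hs2 e (toOp e x) = ENNReal.ofReal (‖x‖ ^ 2) := by
  simp only [hs2, toOp_basis]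
  rw [← x.hasSum_co.tsum_eq, ENNReal.ofReal_tsum_of_nonneg (fun _ => by positivity)
    x.hasSum_co.summable]

theorem isHS_of_hs2 (A : H →L[ℂ] H) (h : hs2 e A ≠ ⊤) : IsHS e A := by
  have := ENNReal.summable_toReal h
  refine this.congr fun i => ?_
  rw [ENNReal.toReal_ofReal (by positivity)]

theorem hs2_adjoint (A : H →L[ℂ] H) : hs2 e (star A) = hs2 e A := by
  have k : ∀ v : H, ENNReal.ofReal (‖v‖ ^ 2) = ∑' j, ENNReal.ofReal (‖(inner ℂ (e j) v : ℂ)‖ ^ 2) := by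
    intro v
    have := parseval e v
    rw [← this.tsum_eq, ENNReal.ofReal_tsum_of_nonneg (fun _ => by positivity) this.summable]
    simp only [HilbertBasis.repr_apply_apply]
  simp only [hs2, k]
  rw [ENNReal.tsum_comm]
  congr 1; funext i; congr 1; funext j
  rw [ContinuousLinearMap.star_eq_adjoint, ContinuousLinearMap.adjoint_inner_right,
    norm_inner_symm]

theorem hs2_mul_left (A C : H →L[ℂ] H) : hs2 e (A * C) ≤ ENNReal.ofReal (‖A‖ ^ 2) * hs2 e C := by
  rw [hs2, hs2, ← ENNReal.tsum_mul_left]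
  refine ENNReal.tsum_le_tsum fun i => ?_
  rw [← ENNReal.ofReal_mul (by positivity)]
  apply ENNReal.ofReal_le_ofReal
  rw [← mul_pow]
  gcongr
  exact A.le_opNorm _

theorem hs2_mul_right (A C : H →L[ℂ] H) : hs2 e (C * A) ≤ ENNReal.ofReal (‖A‖ ^ 2) * hs2 e C := by
  rw [← hs2_adjoint, star_mul, ← hs2_adjoint e C]
  have := hs2_mul_left e (star A) (star C)
  rwa [norm_star] at this

theorem norm_le_of_hs2 (x : HSsp ι H) (y : HSsp ι H) (c : ℝ) (hc : 0 ≤ c)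
    (h : hs2 e (toOp e x) ≤ ENNReal.ofReal (c ^ 2) * hs2 e (toOp e y)) : ‖x‖ ≤ c * ‖y‖ := by
  rw [hs2_toOp, hs2_toOp, ← ENNReal.ofReal_mul (by positivity),
    ENNReal.ofReal_le_ofReal_iff (by positivity), ← mul_pow] at h
  exact le_of_sq_le_sq h (by positivity)

theorem exL (a : H →L[ℂ] H) (x : HSsp ι H) : IsHS e (a * toOp e x) := by
  apply isHS_of_hs2
  refine ne_top_of_le_ne_top ?_ (hs2_mul_left e _ _)
  rw [hs2_toOp]
  exact ENNReal.mul_ne_top ENNReal.ofReal_ne_top ENNReal.ofReal_ne_top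

theorem exR (a : H →L[ℂ] H) (x : HSsp ι H) : IsHS e (toOp e x * a) := by
  apply isHS_of_hs2
  refine ne_top_of_le_ne_top ?_ (hs2_mul_right e _ _)
  rw [hs2_toOp]
  exact ENNReal.mul_ne_top ENNReal.ofReal_ne_top ENNReal.ofReal_ne_top

theorem exJ (x : HSsp ι H) : IsHS e (star (toOp e x)) := by
  apply isHS_of_hs2
  rw [hs2_adjoint, hs2_toOp]
  exact ENNReal.ofReal_ne_top

def opL : (H →L[ℂ] H) →L[ℂ] (HSsp ι H →L[ℂ] HSsp ι H) :=
  LinearMap.mkContinuous₂ (LinearMap.mk₂ ℂ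
    (fun (a : H →L[ℂ] H) (x : HSsp ι H) => mkHS e (a * toOp e x) (exL e a x))
    (fun a b x => by apply toOp_inj e; simp only [map_add, toOp_mk, add_mul])
    (fun c a x => by apply toOp_inj e; simp only [map_smul, toOp_mk, smul_mul_assoc])
    (fun a x y => by apply toOp_inj e; simp only [map_add, toOp_mk, mul_add])
    (fun c a x => by apply toOp_inj e; simp only [map_smul, toOp_mk, mul_smul_comm])) 1
    (fun a x => by
      rw [one_mul]
      apply norm_le_of_hs2 e _ _ _ (norm_nonneg _)
      simp only [LinearMap.mk₂_apply, toOp_mk]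
      exact hs2_mul_left e _ _)

def opR : (H →L[ℂ] H) →L[ℂ] (HSsp ι H →L[ℂ] HSsp ι H) :=
  LinearMap.mkContinuous₂ (LinearMap.mk₂ ℂ
    (fun (a : H →L[ℂ] H) (x : HSsp ι H) => mkHS e (toOp e x * a) (exR e a x))
    (fun a b x => by apply toOp_inj e; simp only [map_add, toOp_mk, mul_add])
    (fun c a x => by apply toOp_inj e; simp only [map_smul, toOp_mk, mul_smul_comm])
    (fun a x y => by apply toOp_inj e; simp only [map_add, toOp_mk, add_mul])
    (fun c a x => by apply toOp_inj e; simp only [map_smul, toOp_mk, smul_mul_assoc])) 1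
    (fun a x => by
      rw [one_mul]
      apply norm_le_of_hs2 e _ _ _ (norm_nonneg _)
      simp only [LinearMap.mk₂_apply, toOp_mk]
      exact hs2_mul_right e _ _)

theorem toOp_L (a : H →L[ℂ] H) (x : HSsp ι H) : toOp e (opL e a x) = a * toOp e x :=
  toOp_mk e _ (exL e a x)

theorem toOp_R (a : H →L[ℂ] H) (x : HSsp ι H) : toOp e (opR e a x) = toOp e x * a :=
  toOp_mk e _ (exR e a x)

def opJ (x : HSsp ι H) : HSsp ι H := mkHS e (star (toOp e x)) (exJ e x)

theorem toOp_J (x : HSsp ι H) : toOp e (opJ e x) = star (toOp e x) := toOp_mk e _ (exJ e x)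

theorem norm_J (x : HSsp ι H) : ‖opJ e x‖ = ‖x‖ := by
  have h : hs2 e (toOp e (opJ e x)) = hs2 e (toOp e x) := by rw [toOp_J, hs2_adjoint]
  rw [hs2_toOp, hs2_toOp, ENNReal.ofReal_eq_ofReal_iff (by positivity) (by positivity)] at h
  exact (sq_eq_sq₀ (norm_nonneg _) (norm_nonneg _)).1 h

theorem J_J (x : HSsp ι H) : opJ e (opJ e x) = x := by
  apply toOp_inj e; rw [toOp_J, toOp_J, star_star]

theorem J_add (x y : HSsp ι H) : opJ e (x + y) = opJ e x + opJ e y := by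
  apply toOp_inj e; simp only [toOp_J, map_add, star_add]

theorem J_smul (c : ℂ) (x : HSsp ι H) : opJ e (c • x) = star c • opJ e x := by
  apply toOp_inj e; simp only [toOp_J, map_smul, star_smul]

theorem re_inner_J (x y : HSsp ι H) : (inner ℂ (opJ e x) (opJ e y) : ℂ).re = (inner ℂ x y : ℂ).re := by
  have h1 := norm_add_sq (𝕜 := ℂ) x y
  have h2 := norm_add_sq (𝕜 := ℂ) (opJ e x) (opJ e y)
  rw [← J_add, norm_J, norm_J, norm_J, h1] at h2
  simp only [RCLike.re_to_complex] at h2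
  linarith

theorem inner_J (x y : HSsp ι H) : (inner ℂ (opJ e x) (opJ e y) : ℂ) = inner ℂ y x := by
  rw [← inner_conj_symm y x]
  apply Complex.ext
  · rw [re_inner_J, Complex.conj_re]
  · have := re_inner_J e x (Complex.I • y)
    rw [J_smul, inner_smul_right, inner_smul_right] at this
    simp at this
    rw [Complex.conj_im]
    linarith

theorem inner_opL (a : H →L[ℂ] H) (x y : HSsp ι H) :
    (inner ℂ (opL e a x) y : ℂ) = inner ℂ x (opL e (star a) y) := by
  have h1 := HSsp.hasSum_inner (opL e a x) y
  have h2 := HSsp.hasSum_inner x (opL e (star a) y)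
  refine h1.unique (h2.congr_fun ?_)
  intro i
  simp only [← toOp_basis e, toOp_L]
  rw [ContinuousLinearMap.star_eq_adjoint]
  exact (ContinuousLinearMap.adjoint_inner_right a _ _).symm

theorem opR_eq (a : H →L[ℂ] H) (x : HSsp ι H) : opR e a x = opJ e (opL e (star a) (opJ e x)) := by
  apply toOp_inj e; simp only [toOp_J, toOp_L, toOp_R, star_mul, star_star]

theorem inner_opR (a : H →L[ℂ] H) (x y : HSsp ι H) :
    (inner ℂ (opR e a x) y : ℂ) = inner ℂ x (opR e (star a) y) := by
  rw [opR_eq, opR_eq, star_star]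
  conv_lhs => rw [← J_J e y]
  conv_rhs => rw [← J_J e x]
  rw [inner_J, inner_J, inner_opL]

def hsData : HSData (H →L[ℂ] H) (HSsp ι H) where
  T := toOp e
  L := opL e
  R := opR e
  T_inj := toOp_inj e
  norm_T := norm_toOp e
  T_L := toOp_L e
  T_R := toOp_R e
  norm_L a x := by
    apply norm_le_of_hs2 e _ _ _ (norm_nonneg _)
    rw [toOp_L]; exact hs2_mul_left e _ _
  norm_R a x := by
    apply norm_le_of_hs2 e _ _ _ (norm_nonneg _)
    rw [toOp_R]; exact hs2_mul_right e _ _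
  inner_L := inner_opL e
  inner_R := inner_opR e

def pullE (E : Submodule ℝ (H →L[ℂ] H)) : Submodule ℝ (HSsp ι H) where
  carrier := {x | toOp e x ∈ E}
  add_mem' := by
    intro x y hx hy
    simp only [Set.mem_ofPred_eq, map_add] at *
    exact E.add_mem hx hy
  zero_mem' := by simp
  smul_mem' := by
    intro c x hx
    simp only [Set.mem_ofPred_eq] at *
    rw [← Complex.coe_smul c x, map_smul]
    have : (c : ℂ) • toOp e x = c • toOp e x := by
      ext v
      simp
    rw [this]
    exact E.smul_mem c hx

theorem mem_pullE (E : Submodule ℝ (H →L[ℂ] H)) (x : HSsp ι H) :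
    x ∈ pullE e E ↔ toOp e x ∈ E := Iff.rfl

theorem pullE_closed (E : Submodule ℝ (H →L[ℂ] H))
    (hE : ∀ X ∈ E, MemS2 e X) (hclosed : IsHSClosed e (E : Set (H →L[ℂ] H))) :
    IsClosed (pullE e E : Set (HSsp ι H)) := by
  apply isClosed_of_closure_subset
  intro x hx
  have hsc : IsClosed {x : HSsp ι H | IsSelfAdjoint (toOp e x)} := by
    have : Continuous fun x : HSsp ι H => toOp e x := (toOp e).continuous
    exact isClosed_eq (continuous_star.comp this) this
  have hsa : IsSelfAdjoint (toOp e x) :=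
    closure_minimal (s := (pullE e E : Set (HSsp ι H)))
      (t := {x : HSsp ι H | IsSelfAdjoint (toOp e x)}) (fun y hy => (hE _ hy).1) hsc hx
  apply hclosed _ ⟨hsa, toOp_hs e x⟩
  intro ε hε
  obtain ⟨y, hy, hd⟩ := Metric.mem_closure_iff.1 hx ε hε
  refine ⟨toOp e y, hy, ?_⟩
  rw [← map_sub, hsNorm_toOp, ← dist_eq_norm]
  exact hd

end Concrete

end Helpers

/-- For a closed real-linear subspace `E` of `S₂(H)`:
`[X, [X, Y]] ∈ E` for all `X, Y ∈ E` iff `exp X · exp Y · exp X ∈ exp E` for all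
`X, Y ∈ E`. -/
theorem statement10 (e : HilbertBasis ι ℂ H) (E : Submodule ℝ (H →L[ℂ] H))
    (hE : ∀ X ∈ E, MemS2 e X) (hclosed : IsHSClosed e (E : Set (H →L[ℂ] H))) :
    (∀ X ∈ E, ∀ Y ∈ E, brk X (brk X Y) ∈ E) ↔
    (∀ X ∈ E, ∀ Y ∈ E,
      NormedSpace.exp X * NormedSpace.exp Y * NormedSpace.exp X ∈
        expSet (E : Set (H →L[ℂ] H))) := by
  have hcl := pullE_closed e E hE hclosed
  have hsa : ∀ x ∈ pullE e E, IsSelfAdjoint ((hsData e).T x) := fun x hx => (hE _ hx).1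
  constructor
  · intro h X hX Y hY
    obtain ⟨z, hz, hez⟩ := (hsData e).forward (pullE e E) hcl hsa
      (fun x hx d hd => by
        rw [mem_pullE]
        have := h _ hx _ hd
        have e2 : toOp e ((hsData e).ad ((hsData e).T x) ((hsData e).ad ((hsData e).T x) d)) =
            brk (toOp e x) (brk (toOp e x) (toOp e d)) := by
          change (hsData e).T _ = _
          rw [(hsData e).T_ad, (hsData e).T_ad]
          rfl
        rw [e2]; exact this)
      (mkHS e X (hE X hX).2) (by rw [mem_pullE, toOp_mk]; exact hX)
      (mkHS e Y (hE Y hY).2) (by rw [mem_pullE, toOp_mk]; exact hY)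
    refine ⟨toOp e z, hz, ?_⟩
    have e3 : NormedSpace.exp (toOp e z) = _ := hez
    rw [e3]
    change NormedSpace.exp (toOp e _) * NormedSpace.exp (toOp e _) *
      NormedSpace.exp (toOp e _) = _
    rw [toOp_mk, toOp_mk]
  · intro h X hX Y hY
    have hb := (hsData e).backward (pullE e E) hcl hsa
      (fun x hx y hy => by
        obtain ⟨Z, hZ, hez⟩ := h _ hx _ hy
        refine ⟨mkHS e Z (hE Z hZ).2, by rw [mem_pullE, toOp_mk]; exact hZ, ?_⟩
        change NormedSpace.exp (toOp e _) = _
        rw [toOp_mk]; exact hez)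
      (mkHS e X (hE X hX).2) (by rw [mem_pullE, toOp_mk]; exact hX)
      (mkHS e Y (hE Y hY).2) (by rw [mem_pullE, toOp_mk]; exact hY)
    rw [mem_pullE] at hb
    change (hsData e).T _ ∈ E at hb
    rw [(hsData e).T_ad, (hsData e).T_ad] at hb
    change brk (toOp e _) (brk (toOp e _) (toOp e _)) ∈ E at hb
    rw [toOp_mk, toOp_mk] at hb
    exact hb
end
end

section
/- Let E be a closed real-linear subspace of S₂(H) such that [X, [X, Y]] ∈ E for all X, Y ∈ E. Then exp(X) exp(Y) exp(X) ∈ exp E for all X, Y ∈ E if and only if exp E is totally geodesic in P, i.e., for all p, q ∈ exp E and all t ∈ [0, 1], the point p^{1/2} · exp(t · log(p^{−1/2} q p^{−1/2})) · p^{1/2} of the geodesic from p to q belongs to exp E. -/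
noncomputable section

open scoped InnerProductSpace

variable {H : Type*} [NormedAddCommGroup H] [InnerProductSpace ℂ H] [CompleteSpace H]
variable {ι : Type*}

section abstractPart

variable {B S : Type*} [NormedRing B] [NormedAlgebra ℝ B] [CompleteSpace B]
  [NormedAddCommGroup S] [NormedSpace ℝ S] [CompleteSpace S]

/-- Duhamel operator. -/
def Phi (l r : B →L[ℝ] S →L[ℝ] S) (Z A : B) : S →L[ℝ] S :=
  ∫ s in (0:ℝ)..1, (l (NormedSpace.exp (s • Z))).comp (r (NormedSpace.exp ((1 - s) • A)))

lemma exp_cont : Continuous (NormedSpace.exp : B → B) := by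
  let _ : NormedAlgebra ℚ B := NormedAlgebra.restrictScalars ℚ ℝ B
  exact NormedSpace.exp_continuous

lemma Phi_integrand_cont (l r : B →L[ℝ] S →L[ℝ] S) :
    Continuous (fun x : (B × B) × ℝ => (l (NormedSpace.exp (x.2 • x.1.1))).comp
      (r (NormedSpace.exp ((1 - x.2) • x.1.2)))) := by
  have h := exp_cont (B := B)
  apply Continuous.clm_comp
  · exact l.continuous.comp (h.comp (by fun_prop))
  · exact r.continuous.comp (h.comp (by fun_prop))

lemma Phi_cont (l r : B →L[ℝ] S →L[ℝ] S) :
    Continuous (fun x : B × B => Phi l r x.1 x.2) :=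
  intervalIntegral.continuous_parametric_intervalIntegral_of_continuous'
    (f := fun (x : B × B) (s : ℝ) => (l (NormedSpace.exp (s • x.1))).comp
      (r (NormedSpace.exp ((1 - s) • x.2)))) (Phi_integrand_cont l r) 0 1

lemma Phi_cont_left (l r : B →L[ℝ] S →L[ℝ] S) (A : B) :
    Continuous (fun Z : B => Phi l r Z A) := by
  have h : Continuous (fun Z : B => (Z, A)) := by fun_prop
  exact (Phi_cont l r).comp h

lemma Phi_cont1 (l r : B →L[ℝ] S →L[ℝ] S) (Z A : B) :
    Continuous (fun s : ℝ => (l (NormedSpace.exp (s • Z))).comp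
      (r (NormedSpace.exp ((1 - s) • A)))) :=
  (Phi_integrand_cont l r).comp (f := fun s : ℝ => ((Z, A), s)) (by fun_prop)

lemma Phi_apply (l r : B →L[ℝ] S →L[ℝ] S) (Z A : B) (w : S) :
    Phi l r Z A w = ∫ s in (0:ℝ)..1, l (NormedSpace.exp (s • Z))
      (r (NormedSpace.exp ((1 - s) • A)) w) := by
  have := ContinuousLinearMap.intervalIntegral_apply
    ((Phi_cont1 l r Z A).intervalIntegrable (μ := MeasureTheory.volume) 0 1) w
  exact this

lemma Phi_clm {G : Type*} [NormedAddCommGroup G] [NormedSpace ℝ G] [CompleteSpace G]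
    (f : S →L[ℝ] G) (l r : B →L[ℝ] S →L[ℝ] S) (Z A : B) (w : S) :
    f (Phi l r Z A w) = ∫ s in (0:ℝ)..1, f (l (NormedSpace.exp (s • Z))
      (r (NormedSpace.exp ((1 - s) • A)) w)) := by
  rw [Phi_apply]
  refine (ContinuousLinearMap.intervalIntegral_comp_comm f ?_).symm
  have h : Continuous fun s : ℝ => l (NormedSpace.exp (s • Z))
      (r (NormedSpace.exp ((1 - s) • A)) w) := (Phi_cont1 l r Z A).clm_apply continuous_const
  exact h.intervalIntegrable 0 1

lemma duhamel (l r : B →L[ℝ] S →L[ℝ] S) (j : S →L[ℝ] B)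
    (hl : ∀ a s, j (l a s) = a * j s) (hr : ∀ a s, j (r a s) = j s * a)
    (Z A : B) (d : S) (hd : j d = Z - A) :
    j (Phi l r Z A d) = NormedSpace.exp Z - NormedSpace.exp A := by
  rw [Phi_clm]
  have hder : ∀ s : ℝ, HasDerivAt (fun s : ℝ => NormedSpace.exp (s • Z) *
      NormedSpace.exp ((1 - s) • A))
      (j (l (NormedSpace.exp (s • Z)) (r (NormedSpace.exp ((1 - s) • A)) d))) s := by
    intro s
    have h1 := hasDerivAt_exp_smul_const (𝕂 := ℝ) Z s
    have h2 := (hasDerivAt_exp_smul_const' (𝕂 := ℝ) A (1 - s)).scomp s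
      ((hasDerivAt_id s).const_sub 1)
    convert! h1.mul h2 using 1
    rw [hl, hr, hd]
    simp
    noncomm_ring
  rw [intervalIntegral.integral_eq_sub_of_hasDerivAt (fun s _ => hder s)]
  · simp
  · apply Continuous.intervalIntegrable
    exact j.continuous.comp ((Phi_cont1 l r Z A).clm_apply continuous_const)

lemma exp_act (f : B →L[ℝ] S →L[ℝ] S) (X : B) (w : S)
    (hf : ∀ n : ℕ, (f X ^ n) w = f (X ^ n) w) :
    NormedSpace.exp (f X) w = f (NormedSpace.exp X) w := by
  have h1 := NormedSpace.exp_series_hasSum_exp' (𝕂 := ℝ) (f X)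
  have h2 := NormedSpace.exp_series_hasSum_exp' (𝕂 := ℝ) X
  have h3 := h1.mapL (ContinuousLinearMap.apply ℝ S w)
  have h4 := h2.mapL (f.flip w)
  refine h3.unique ?_
  convert! h4 using 1
  funext n
  simp [hf]

lemma conj_mem (l r : B →L[ℝ] S →L[ℝ] S) (j : S →L[ℝ] B) (hj : Function.Injective j)
    (hl : ∀ a s, j (l a s) = a * j s) (hr : ∀ a s, j (r a s) = j s * a)
    (ES : Submodule ℝ S) (hES : IsClosed (ES : Set S)) (X : B)
    (hbr : ∀ w ∈ ES, (l X - r X) ((l X - r X) w) ∈ ES) (w : S) (hw : w ∈ ES) :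
    l (NormedSpace.exp X) (r (NormedSpace.exp (-X)) w) +
      l (NormedSpace.exp (-X)) (r (NormedSpace.exp X) w) ∈ ES := by
  have hlp : ∀ (Y : B) (n : ℕ) (w : S), (l Y ^ n) w = l (Y ^ n) w := by
    intro Y n
    induction n with
    | zero => intro w; apply hj; simp [hl]
    | succ n ih => intro w; apply hj; simp [pow_succ, ih, hl, mul_assoc]
  have hrp : ∀ (Y : B) (n : ℕ) (w : S), (r Y ^ n) w = r (Y ^ n) w := by
    intro Y n
    induction n with
    | zero => intro w; apply hj; simp [hr]
    | succ n ih => intro w; apply hj; simp [pow_succ', pow_succ Y n, ih, hr, mul_assoc]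
  have hcomm : ∀ Y Y' : B, Commute (l Y) (r Y') := by
    intro Y Y'
    ext w
    apply hj
    simp [hl, hr, mul_assoc]
  have key : ∀ Y : B, NormedSpace.exp (l Y - r Y) w =
      l (NormedSpace.exp Y) (r (NormedSpace.exp (-Y)) w) := by
    intro Y
    let _ : NormedAlgebra ℚ (S →L[ℝ] S) := NormedAlgebra.restrictScalars ℚ ℝ _
    have : l Y - r Y = l Y + r (-Y) := by simp [sub_eq_add_neg]
    rw [this, NormedSpace.exp_add_of_commute (hcomm _ _)]
    simp only [mul_apply_eq_comp]
    rw [exp_act r (-Y) _ (fun n => hrp _ _ _), exp_act l Y _ (fun n => hlp _ _ _)]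
  have h1 := key X
  have h2 := key (-X)
  rw [neg_neg] at h2
  rw [← h1, ← h2]
  have e2 : l (-X) - r (-X) = -(l X - r X) := by simp; abel
  rw [e2]
  set T := l X - r X with hT
  have s1 := (NormedSpace.exp_series_hasSum_exp' (𝕂 := ℝ) T).mapL (ContinuousLinearMap.apply ℝ S w)
  have s2 := (NormedSpace.exp_series_hasSum_exp' (𝕂 := ℝ) (-T)).mapL
    (ContinuousLinearMap.apply ℝ S w)
  have s3 := s1.add s2
  have hev : ∀ n : ℕ, (T ^ (2 * n)) w ∈ ES := by
    intro n
    induction n with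
    | zero => simpa using hw
    | succ n ih =>
      have : T ^ (2 * (n + 1)) = T * (T * T ^ (2 * n)) := by
        rw [← mul_assoc, ← sq, ← pow_add]; congr 1; ring
      rw [this]
      exact hbr _ ih
  refine hES.mem_of_tendsto s3 (Filter.Eventually.of_forall fun F => ?_)
  refine ES.sum_mem fun n _ => ?_
  rcases Nat.even_or_odd' n with ⟨m, rfl | rfl⟩
  · have : (-T) ^ (2 * m) = T ^ (2 * m) := by rw [Even.neg_pow (by simp)]
    simp only [this]
    refine ES.add_mem ?_ ?_ <;> exact ES.smul_mem _ (hev m)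
  · have : (-T) ^ (2 * m + 1) = -T ^ (2 * m + 1) := by rw [Odd.neg_pow (by simp)]
    simp only [this]
    simp

lemma Phi_conj_mem (l r : B →L[ℝ] S →L[ℝ] S) (j : S →L[ℝ] B) (hj : Function.Injective j)
    (hl : ∀ a s, j (l a s) = a * j s) (hr : ∀ a s, j (r a s) = j s * a)
    (ES : Submodule ℝ S) (hES : IsClosed (ES : Set S)) (X : B)
    (hbr : ∀ w ∈ ES, (l X - r X) ((l X - r X) w) ∈ ES) (w : S) (hw : w ∈ ES) :
    l (NormedSpace.exp X) (r (NormedSpace.exp X)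
      (Phi l r ((-2 : ℝ) • X) ((-2 : ℝ) • X) w)) ∈ ES := by
  have hexp : ∀ a b : ℝ, NormedSpace.exp (a • X) * NormedSpace.exp (b • X) =
      NormedSpace.exp ((a + b) • X) := by
    intro a b
    let _ : NormedAlgebra ℚ B := NormedAlgebra.restrictScalars ℚ ℝ B
    rw [add_smul, NormedSpace.exp_add_of_commute]
    exact ((Commute.refl X).smul_left a).smul_right b
  set g : ℝ → S := fun u => l (NormedSpace.exp (u • X)) (r (NormedSpace.exp ((-u) • X)) w) with hg
  have hgc : Continuous g := by
    have h := exp_cont (B := B)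
    refine Continuous.clm_apply (l.continuous.comp (h.comp (by fun_prop))) ?_
    exact Continuous.clm_apply (r.continuous.comp (h.comp (by fun_prop))) continuous_const
  have e1 : l (NormedSpace.exp X) (r (NormedSpace.exp X)
      (Phi l r ((-2 : ℝ) • X) ((-2 : ℝ) • X) w)) = ∫ s in (0:ℝ)..1, g (1 - 2 * s) := by
    have := Phi_clm ((l (NormedSpace.exp X)).comp (r (NormedSpace.exp X))) l r
      ((-2 : ℝ) • X) ((-2 : ℝ) • X) w
    rw [ContinuousLinearMap.comp_apply] at this
    rw [this]
    congr 1
    funext s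
    apply hj
    simp only [hg, ContinuousLinearMap.comp_apply, hl, hr, smul_smul]
    have a1 : NormedSpace.exp ((1 - 2 * s) • X) =
        NormedSpace.exp X * NormedSpace.exp ((s * -2) • X) := by
      conv_rhs => rw [← one_smul ℝ X, smul_smul, hexp]
      congr 2; ring
    have a2 : NormedSpace.exp ((-(1 - 2 * s)) • X) =
        NormedSpace.exp (((1 - s) * -2) • X) * NormedSpace.exp X := by
      conv_rhs => rw [← one_smul ℝ X, smul_smul, hexp]
      congr 2; ring
    rw [a1, a2]
    simp only [mul_assoc]
  have e2 : ∫ s in (0:ℝ)..1, g (1 - 2 * s) = ∫ s in (0:ℝ)..1, g (-(1 - 2 * s)) := by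
    have := intervalIntegral.integral_comp_sub_left (a := 0) (b := 1)
      (fun s => g (1 - 2 * s)) (1 : ℝ)
    simp only [sub_self, sub_zero] at this
    rw [← this]
    congr 1
    funext s
    congr 1
    ring
  have e3 : (2 : ℝ) • (∫ s in (0:ℝ)..1, g (1 - 2 * s)) =
      ∫ s in (0:ℝ)..1, (g (1 - 2 * s) + g (-(1 - 2 * s))) := by
    rw [intervalIntegral.integral_add, ← e2, two_smul]
    · exact (hgc.comp (by fun_prop)).intervalIntegrable _ _
    · exact (hgc.comp (by fun_prop)).intervalIntegrable _ _
  have hmem : ∀ u : ℝ, g u + g (-u) ∈ ES := by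
    intro u
    have := conj_mem l r j hj hl hr ES hES (u • X) (fun w hw => by
      have : (l (u • X) - r (u • X)) ((l (u • X) - r (u • X)) w) =
        (u * u) • (l X - r X) ((l X - r X) w) := by
          simp only [map_smul, ← smul_sub, smul_apply, smul_smul]
      rw [this]
      exact ES.smul_mem _ (hbr w hw)) w hw
    simpa [hg] using this
  rw [e1]
  have : ∫ s in (0:ℝ)..1, (g (1 - 2 * s) + g (-(1 - 2 * s))) ∈ ES := by
    rw [intervalIntegral.integral_of_le zero_le_one]
    have : MeasureTheory.IsProbabilityMeasure
      (MeasureTheory.volume.restrict (Set.Ioc (0:ℝ) 1)) := ⟨by simp⟩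
    have hc : Continuous fun s : ℝ => (g (1 - 2 * s) + g (-(1 - 2 * s))) :=
      (hgc.comp (by fun_prop)).add (hgc.comp (by fun_prop))
    refine Convex.integral_mem (s := (ES : Set S)) (ES.convex) hES
      (Filter.Eventually.of_forall fun s => hmem _) ?_
    have := hc.intervalIntegrable (μ := MeasureTheory.volume) 0 1
    rwa [intervalIntegrable_iff_integrableOn_Ioc_of_le zero_le_one] at this
  rw [← e3] at this
  have h2 := ES.smul_mem (2⁻¹ : ℝ) this
  rwa [smul_smul, inv_mul_cancel₀ two_ne_zero, one_smul] at h2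

set_option maxHeartbeats 1000000 in
theorem core (l r : B →L[ℝ] S →L[ℝ] S) (j : S →L[ℝ] B) (hj : Function.Injective j)
    (hl : ∀ a s, j (l a s) = a * j s) (hr : ∀ a s, j (r a s) = j s * a)
    (ES : Submodule ℝ S) (hES : IsClosed (ES : Set S)) (X K : B)
    (hbr : ∀ w ∈ ES, (l X - r X) ((l X - r X) w) ∈ ES) (k : S) (hk : j k = K)
    (Z : ℕ → B) (d : ℕ → S) (hd : ∀ n, d n ∈ ES) (hjd : ∀ n, j (d n) = Z n - (-2 : ℝ) • X)
    (hZ : ∀ n, NormedSpace.exp (Z n) = NormedSpace.exp (-X) *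
      NormedSpace.exp ((1 / ((n : ℝ) + 1)) • K) * NormedSpace.exp (-X))
    (C : ℝ) (hlow : ∀ n w, ‖w‖ ≤ C * ‖Phi l r (Z n) ((-2 : ℝ) • X) w‖) : k ∈ ES := by
  let _ : NormedAlgebra ℚ B := NormedAlgebra.restrictScalars ℚ ℝ B
  set A : B := (-2 : ℝ) • X with hA
  set t : ℕ → ℝ := fun n => 1 / ((n : ℝ) + 1) with ht
  have htpos : ∀ n, 0 < t n := fun n => by positivity
  have ht0 : Filter.Tendsto t Filter.atTop (nhds 0) := tendsto_one_div_add_atTop_nhds_zero_nat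
  set w : ℕ → S := fun n => (t n)⁻¹ • d n with hw
  have hwES : ∀ n, w n ∈ ES := fun n => ES.smul_mem _ (hd n)
  have hdw : ∀ n, d n = t n • w n := fun n => by
    simp [hw, smul_smul, mul_inv_cancel₀ (htpos n).ne']
  have hex : NormedSpace.exp X * NormedSpace.exp (-X) = 1 := by
    rw [← NormedSpace.exp_add_of_commute (Commute.neg_right (Commute.refl X))]; simp
  have hex' : NormedSpace.exp (-X) * NormedSpace.exp X = 1 := by
    rw [← NormedSpace.exp_add_of_commute (Commute.neg_left (Commute.refl X))]; simp
  have hexA : NormedSpace.exp A = NormedSpace.exp (-X) * NormedSpace.exp (-X) := by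
    rw [← NormedSpace.exp_add_of_commute (Commute.refl (-X))]
    congr 1
    rw [hA, neg_smul, two_smul]; abel
  -- main identity
  have hid : ∀ n, Phi l r (Z n) A (w n) = l (NormedSpace.exp (-X)) (r (NormedSpace.exp (-X))
      (Phi l r (t n • K) 0 k)) := by
    intro n
    have h1 : Phi l r (Z n) A (d n) = l (NormedSpace.exp (-X)) (r (NormedSpace.exp (-X))
      (Phi l r (t n • K) 0 (t n • k))) := by
      apply hj
      rw [duhamel l r j hl hr _ _ _ (hjd n), hl, hr,
        duhamel l r j hl hr (t n • K) 0 _ (by simp [hk]), hZ n, hexA]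
      simp only [NormedSpace.exp_zero]
      noncomm_ring
    rw [hdw n] at h1
    simp only [map_smul] at h1
    exact smul_right_injective S (htpos n).ne' h1
  -- convergence of the right factor
  have hkap : Filter.Tendsto (fun n => Phi l r (t n • K) 0 k) Filter.atTop (nhds k) := by
    have hc : Continuous fun s : ℝ => Phi l r (s • K) 0 k := by
      have : Continuous fun s : ℝ => Phi l r (s • K) 0 :=
        (Phi_cont l r).comp (f := fun s : ℝ => (s • K, (0 : B))) (by fun_prop)
      exact this.clm_apply continuous_const
    have h0 : Phi l r ((0 : ℝ) • K) 0 k = k := by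
      rw [Phi_apply]
      have : ∀ s : ℝ, l (NormedSpace.exp (s • (0 : ℝ) • K))
          (r (NormedSpace.exp ((1 - s) • (0 : B))) k) = k := by
        intro s; apply hj; rw [hl, hr]; simp
      simp only [this]; simp
    have := (hc.tendsto 0).comp ht0
    rw [h0] at this
    exact this
  have hrhs : Filter.Tendsto (fun n => Phi l r (Z n) A (w n)) Filter.atTop
      (nhds (l (NormedSpace.exp (-X)) (r (NormedSpace.exp (-X)) k))) := by
    simp only [hid]
    exact ((l (NormedSpace.exp (-X))).continuous.tendsto _).comp
      (((r (NormedSpace.exp (-X))).continuous.tendsto _).comp hkap)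
  -- boundedness of `w`
  obtain ⟨M, hM⟩ : ∃ M, ∀ n, ‖w n‖ ≤ M := by
    obtain ⟨M, hM⟩ := hrhs.norm.bddAbove_range
    refine ⟨|C| * M, fun n => (hlow n (w n)).trans ?_⟩
    calc C * ‖Phi l r (Z n) A (w n)‖ ≤ |C| * ‖Phi l r (Z n) A (w n)‖ := by
          gcongr; exact le_abs_self C
      _ ≤ |C| * M := by
          gcongr; exact hM ⟨n, rfl⟩
  have hd0 : Filter.Tendsto d Filter.atTop (nhds 0) := by
    refine squeeze_zero_norm (a := fun n => t n * M) (fun n => ?_) (by simpa using ht0.mul_const M)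
    rw [hdw n, norm_smul, Real.norm_of_nonneg (htpos n).le]
    exact mul_le_mul_of_nonneg_left (hM n) (htpos n).le
  have hZA : Filter.Tendsto Z Filter.atTop (nhds A) := by
    have h1 := (j.continuous.tendsto 0).comp hd0
    have h2 := h1.add_const A
    simpa [Function.comp_def, hjd] using h2
  have hPhi : Filter.Tendsto (fun n => Phi l r (Z n) A - Phi l r A A) Filter.atTop (nhds 0) := by
    have h1 : Filter.Tendsto (fun n => Phi l r (Z n) A) Filter.atTop (nhds (Phi l r A A)) :=
      ((Phi_cont_left l r A).tendsto A).comp hZA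
    simpa using h1.sub_const (Phi l r A A)
  have hdiff : Filter.Tendsto (fun n => (Phi l r (Z n) A - Phi l r A A) (w n))
      Filter.atTop (nhds 0) := by
    refine squeeze_zero_norm (a := fun n => ‖Phi l r (Z n) A - Phi l r A A‖ * M) (fun n => ?_)
      (by simpa using hPhi.norm.mul_const M)
    refine (ContinuousLinearMap.le_opNorm _ _).trans ?_
    exact mul_le_mul_of_nonneg_left (hM n) (norm_nonneg _)
  have hfin : Filter.Tendsto (fun n => Phi l r A A (w n)) Filter.atTop
      (nhds (l (NormedSpace.exp (-X)) (r (NormedSpace.exp (-X)) k))) := by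
    have := hrhs.sub hdiff
    simpa using this
  have hfin2 : Filter.Tendsto (fun n => l (NormedSpace.exp X) (r (NormedSpace.exp X)
      (Phi l r A A (w n)))) Filter.atTop (nhds k) := by
    have := ((l (NormedSpace.exp X)).continuous.tendsto _).comp
      (((r (NormedSpace.exp X)).continuous.tendsto _).comp hfin)
    have hkk : l (NormedSpace.exp X) (r (NormedSpace.exp X)
        (l (NormedSpace.exp (-X)) (r (NormedSpace.exp (-X)) k))) = k := by
      apply hj
      simp only [hl, hr]
      calc _ = (NormedSpace.exp X * NormedSpace.exp (-X)) * j k *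
            (NormedSpace.exp (-X) * NormedSpace.exp X) := by noncomm_ring
        _ = j k := by rw [hex, hex']; simp
    rw [hkk] at this
    exact this
  exact hES.mem_of_tendsto hfin2 (Filter.Eventually.of_forall fun n =>
    Phi_conj_mem l r j hj hl hr ES hES X hbr (w n) (hwES n))

lemma Phi_low [StarRing B] [StarModule ℝ B] [ContinuousStar B]
    (l r : B →L[ℝ] S →L[ℝ] S) (j : S →L[ℝ] B) (hj : Function.Injective j)
    (hl : ∀ a s, j (l a s) = a * j s) (hr : ∀ a s, j (r a s) = j s * a)
    (hln : ∀ a s, ‖l a s‖ ≤ ‖a‖ * ‖s‖) (hrn : ∀ a s, ‖r a s‖ ≤ ‖a‖ * ‖s‖)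
    (β : S →L[ℝ] S →L[ℝ] ℝ) (hβ : ∀ s, β s s = ‖s‖ ^ 2) (hβ2 : ∀ s t, β s t ≤ ‖s‖ * ‖t‖)
    (hβl : ∀ a, IsSelfAdjoint a → ∀ s t, β s (l a t) = β (l a s) t)
    (hβr : ∀ a, IsSelfAdjoint a → ∀ s t, β s (r a t) = β (r a s) t)
    (Z A : B) (hZ : IsSelfAdjoint Z) (hA : IsSelfAdjoint A) (c : ℝ) (hc : 0 ≤ c)
    (hcZ : ∀ s ∈ Set.Icc (0:ℝ) 1, ‖NormedSpace.exp (-(s / 2) • Z)‖ ≤ c)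
    (hcA : ∀ s ∈ Set.Icc (0:ℝ) 1, ‖NormedSpace.exp (-(s / 2) • A)‖ ≤ c) (w : S) :
    ‖w‖ ≤ c ^ 4 * ‖Phi l r Z A w‖ := by
  have hexp : ∀ (X : B) (a b : ℝ), NormedSpace.exp (a • X) * NormedSpace.exp (b • X) =
      NormedSpace.exp ((a + b) • X) := by
    intro X a b
    let _ : NormedAlgebra ℚ B := NormedAlgebra.restrictScalars ℚ ℝ B
    rw [add_smul, NormedSpace.exp_add_of_commute]
    exact ((Commute.refl X).smul_left a).smul_right b
  have hsa : ∀ (X : B) (a : ℝ), IsSelfAdjoint X → IsSelfAdjoint (NormedSpace.exp (a • X)) := by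
    intro X a hX
    exact (IsSelfAdjoint.smul (IsSelfAdjoint.all a) hX).exp
  have hpt : ∀ s ∈ Set.Icc (0:ℝ) 1, ‖w‖ ^ 2 ≤ c ^ 4 * β w (l (NormedSpace.exp (s • Z))
      (r (NormedSpace.exp ((1 - s) • A)) w)) := by
    intro s hs
    have hs' : 1 - s ∈ Set.Icc (0:ℝ) 1 := ⟨by linarith [hs.2], by linarith [hs.1]⟩
    set a := NormedSpace.exp ((s / 2) • Z) with ha
    set b := NormedSpace.exp (((1 - s) / 2) • A) with hb
    set a' := NormedSpace.exp (-(s / 2) • Z) with ha'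
    set b' := NormedSpace.exp (-((1 - s) / 2) • A) with hb'
    have haa : NormedSpace.exp (s • Z) = a * a := by rw [ha, hexp]; congr 2; ring
    have hbb : NormedSpace.exp ((1 - s) • A) = b * b := by rw [hb, hexp]; congr 2; ring
    have h1 : a' * a = 1 := by rw [ha, ha', hexp]; simp
    have h2 : b * b' = 1 := by rw [hb, hb', hexp]; simp
    have hasa : IsSelfAdjoint a := hsa _ _ hZ
    have hbsa : IsSelfAdjoint b := hsa _ _ hA
    have e1 : l (NormedSpace.exp (s • Z)) (r (NormedSpace.exp ((1 - s) • A)) w) =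
        l a (r b (l a (r b w))) := by
      apply hj; simp only [hl, hr, haa, hbb, mul_assoc]
    have e2 : r b (l a w) = l a (r b w) := by
      apply hj; simp only [hl, hr, mul_assoc]
    have e3 : w = l a' (r b' (l a (r b w))) := by
      apply hj; simp only [hl, hr]
      calc j w = (a' * a) * j w * (b * b') := by rw [h1, h2]; simp
        _ = _ := by noncomm_ring
    rw [e1, hβl a hasa, hβr b hbsa, e2, hβ]
    have h3 : ‖w‖ ≤ c * (c * ‖l a (r b w)‖) := by
      conv_lhs => rw [e3]
      refine (hln _ _).trans ?_
      refine mul_le_mul (hcZ s hs) ?_ (norm_nonneg _) hc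
      refine (hrn _ _).trans ?_
      exact mul_le_mul_of_nonneg_right (hcA _ hs') (norm_nonneg _)
    calc ‖w‖ ^ 2 ≤ (c * (c * ‖l a (r b w)‖)) ^ 2 := by gcongr
      _ = _ := by ring
  have hint : ‖w‖ ^ 2 ≤ c ^ 4 * β w (Phi l r Z A w) := by
    rw [Phi_clm (β w) l r Z A w, ← intervalIntegral.integral_const_mul]
    have hc1 : Continuous fun s : ℝ => β w (l (NormedSpace.exp (s • Z))
        (r (NormedSpace.exp ((1 - s) • A)) w)) :=
      (β w).continuous.comp ((Phi_cont1 l r Z A).clm_apply continuous_const)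
    calc ‖w‖ ^ 2 = ∫ s in (0:ℝ)..1, ‖w‖ ^ 2 := by simp
      _ ≤ _ := intervalIntegral.integral_mono_on zero_le_one (by simp)
          ((hc1.const_mul _).intervalIntegrable 0 1) hpt
  have h4 : ‖w‖ ^ 2 ≤ c ^ 4 * (‖w‖ * ‖Phi l r Z A w‖) :=
    hint.trans (mul_le_mul_of_nonneg_left (hβ2 _ _) (by positivity))
  rcases (norm_nonneg w).eq_or_lt with h0 | h0
  · rw [← h0]; positivity
  · have : ‖w‖ * ‖w‖ ≤ ‖w‖ * (c ^ 4 * ‖Phi l r Z A w‖) := by nlinarith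
    exact le_of_mul_le_mul_left this h0

end abstractPart
set_option linter.unusedSectionVars false

section hsPart

lemma parseval_s11 (e : HilbertBasis ι ℂ H) (x : H) :
    HasSum (fun i => ‖(inner ℂ (e i) x : ℂ)‖ ^ 2) (‖x‖ ^ 2) := by
  have h := e.hasSum_inner_mul_inner x x
  have h2 := Complex.hasSum_re h
  convert! h2 using 1
  · funext i
    rw [← inner_conj_symm x (e i), ← Complex.normSq_eq_conj_mul_self, Complex.ofReal_re,
      Complex.normSq_eq_norm_sq]
  · rw [inner_self_eq_norm_sq_to_K]
    norm_cast

lemma hs_adj (e : HilbertBasis ι ℂ H) {A : H →L[ℂ] H} (hA : IsHS e A) :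
    IsHS e (star A) ∧ ∑' i, ‖(star A) (e i)‖ ^ 2 = ∑' i, ‖A (e i)‖ ^ 2 := by
  set f : ι → ι → ℝ := fun i j => ‖(inner ℂ (e j) (A (e i)) : ℂ)‖ ^ 2 with hf
  have h1 : ∀ i, HasSum (f i) (‖A (e i)‖ ^ 2) := fun i => parseval_s11 e _
  have h2 : ∀ j, HasSum (fun i => f i j) (‖(star A) (e j)‖ ^ 2) := fun j => by
    convert! parseval_s11 e ((star A) (e j)) using 1
    funext i
    rw [hf, ContinuousLinearMap.star_eq_adjoint, ContinuousLinearMap.adjoint_inner_right,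
      norm_inner_symm]
  have hs : Summable (Function.uncurry f) := by
    rw [summable_prod_of_nonneg (fun _ => by simp only [hf, Function.uncurry, Pi.zero_apply]; positivity)]
    refine ⟨fun i => (h1 i).summable, ?_⟩
    simp only [Function.uncurry, (h1 _).tsum_eq]
    exact hA
  have hs' : Summable (Function.uncurry (fun j i => f i j)) := hs.prod_symm
  constructor
  · have := hs'.prod
    simp only [Function.uncurry, (h2 _).tsum_eq] at this
    exact this
  · have := hs.tsum_comm
    simp only [(h1 _).tsum_eq, (h2 _).tsum_eq] at this
    exact this

lemma hs_left (e : HilbertBasis ι ℂ H) (a : H →L[ℂ] H) {A : H →L[ℂ] H} (hA : IsHS e A) :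
    IsHS e (a * A) ∧ ∑' i, ‖(a * A) (e i)‖ ^ 2 ≤ ‖a‖ ^ 2 * ∑' i, ‖A (e i)‖ ^ 2 := by
  have hb : ∀ i, ‖(a * A) (e i)‖ ^ 2 ≤ ‖a‖ ^ 2 * ‖A (e i)‖ ^ 2 := fun i => by
    rw [← mul_pow]
    exact pow_le_pow_left₀ (norm_nonneg _) (a.le_opNorm _) 2
  have hs : Summable fun i => ‖a‖ ^ 2 * ‖A (e i)‖ ^ 2 := Summable.mul_left _ hA
  have h1 : IsHS e (a * A) := Summable.of_nonneg_of_le (fun i => by positivity) hb hs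
  refine ⟨h1, ?_⟩
  rw [← tsum_mul_left]
  exact h1.tsum_le_tsum hb hs

lemma hs_right (e : HilbertBasis ι ℂ H) (a : H →L[ℂ] H) {A : H →L[ℂ] H} (hA : IsHS e A) :
    IsHS e (A * a) ∧ ∑' i, ‖(A * a) (e i)‖ ^ 2 ≤ ‖a‖ ^ 2 * ∑' i, ‖A (e i)‖ ^ 2 := by
  have h1 := hs_adj e hA
  have h2 := hs_left e (star a) h1.1
  have h3 := hs_adj e h2.1
  rw [star_mul, star_star, star_star] at h3
  refine ⟨h3.1, ?_⟩
  rw [h3.2]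
  refine h2.2.trans ?_
  rw [h1.2, norm_star]

lemma hs_opNorm (e : HilbertBasis ι ℂ H) {A : H →L[ℂ] H} (hA : IsHS e A) :
    ‖A‖ ≤ Real.sqrt (∑' i, ‖A (e i)‖ ^ 2) := by
  rw [← norm_star A]
  refine ContinuousLinearMap.opNorm_le_bound _ (Real.sqrt_nonneg _) fun y => ?_
  have h1 := parseval_s11 e ((star A) y)
  refine abs_le_of_sq_le_sq' ?_ (by positivity) |>.2
  rw [mul_pow, Real.sq_sqrt (tsum_nonneg fun i => by positivity), ← tsum_mul_right, ← h1.tsum_eq]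
  refine h1.summable.tsum_le_tsum (fun i => ?_) (Summable.mul_right _ hA)
  rw [ContinuousLinearMap.star_eq_adjoint, ContinuousLinearMap.adjoint_inner_right, ← mul_pow]
  exact pow_le_pow_left₀ (norm_nonneg _) (norm_inner_le_norm _ _) 2

lemma hs_memlp (e : HilbertBasis ι ℂ H) {A : H →L[ℂ] H} :
    IsHS e A ↔ Memℓp (fun i => A (e i)) 2 := by
  rw [memℓp_gen_iff (by simp)]
  simp [IsHS]

/-- The space of Hilbert-Schmidt operators. -/
def HSop (e : HilbertBasis ι ℂ H) : Submodule ℝ ((H →L[ℂ] H) × lp (fun _ : ι => H) 2) where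
  carrier := {x | ∀ i, x.1 (e i) = x.2 i}
  add_mem' := by
    intro x y hx hy i
    simp [hx i, hy i]
  zero_mem' := by intro i; simp
  smul_mem' := by
    intro c x hx i
    simp [hx i]

lemma HSop_closed (e : HilbertBasis ι ℂ H) : IsClosed (HSop e : Set ((H →L[ℂ] H) × lp (fun _ : ι => H) 2)) := by
  have : (HSop e : Set ((H →L[ℂ] H) × lp (fun _ : ι => H) 2)) =
      ⋂ i, {x | x.1 (e i) = x.2 i} := by
    ext x; rw [Set.mem_iInter]; rfl
  rw [this]
  refine isClosed_iInter fun i => isClosed_eq ?_ ?_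
  · fun_prop
  · exact (lp.evalCLM ℂ (fun _ : ι => H) 2 i).continuous.comp continuous_snd

instance (e : HilbertBasis ι ℂ H) : CompleteSpace (HSop e) :=
  (HSop_closed e).completeSpace_coe

/-- The operator underlying an element. -/
def HSop.j (e : HilbertBasis ι ℂ H) : HSop e →L[ℝ] (H →L[ℂ] H) :=
  (ContinuousLinearMap.fst ℝ _ _).comp (HSop e).subtypeL

lemma HSop.j_inj (e : HilbertBasis ι ℂ H) : Function.Injective (HSop.j e) := by
  intro x y hxy
  have h : x.1.1 = y.1.1 := hxy
  refine Subtype.ext (Prod.ext h ?_)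
  ext i
  rw [← x.2 i, ← y.2 i, h]

lemma HSop.hs {e : HilbertBasis ι ℂ H} (x : HSop e) : IsHS e (HSop.j e x) := by
  rw [hs_memlp]
  have : (fun i => (HSop.j e x) (e i)) = x.1.2 := by
    funext i; exact x.2 i
  rw [this]
  exact lp.memℓp _

/-- Constructor. -/
def HSop.mk (e : HilbertBasis ι ℂ H) (A : H →L[ℂ] H) (hA : IsHS e A) : HSop e :=
  ⟨(A, ⟨fun i => A (e i), (hs_memlp e).1 hA⟩), fun _ => rfl⟩

@[simp] lemma HSop.j_mk (e : HilbertBasis ι ℂ H) (A : H →L[ℂ] H) (hA : IsHS e A) :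
    HSop.j e (HSop.mk e A hA) = A := rfl

lemma HSop.norm_snd {e : HilbertBasis ι ℂ H} (x : HSop e) :
    ‖x.1.2‖ = Real.sqrt (∑' i, ‖(HSop.j e x) (e i)‖ ^ 2) := by
  rw [lp.norm_eq_tsum_rpow (by simp), Real.sqrt_eq_rpow]
  simp only [ENNReal.toReal_ofNat, Real.rpow_ofNat]
  congr 2
  funext i
  rw [← x.2 i]; rfl

lemma HSop.norm_eq {e : HilbertBasis ι ℂ H} (x : HSop e) :
    ‖x‖ = Real.sqrt (∑' i, ‖(HSop.j e x) (e i)‖ ^ 2) := by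
  rw [← HSop.norm_snd]
  change max ‖x.1.1‖ ‖x.1.2‖ = _
  refine max_eq_right ?_
  rw [HSop.norm_snd]
  exact hs_opNorm e (HSop.hs x)

lemma HSop.norm_eq' {e : HilbertBasis ι ℂ H} (x : HSop e) : ‖x‖ = ‖x.1.2‖ := by
  rw [HSop.norm_eq, HSop.norm_snd]

lemma sqrt_aux {a b c : ℝ} (hc : 0 ≤ c) (h : a ≤ c ^ 2 * b) :
    Real.sqrt a ≤ c * Real.sqrt b := by
  calc Real.sqrt a ≤ Real.sqrt (c ^ 2 * b) := Real.sqrt_le_sqrt h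
    _ = c * Real.sqrt b := by rw [Real.sqrt_mul (by positivity), Real.sqrt_sq hc]

/-- Left multiplication, as a function. -/
def HSop.lf (e : HilbertBasis ι ℂ H) (a : H →L[ℂ] H) (x : HSop e) : HSop e :=
  HSop.mk e (a * HSop.j e x) (hs_left e a (HSop.hs x)).1

lemma HSop.j_lf (e : HilbertBasis ι ℂ H) (a : H →L[ℂ] H) (x : HSop e) :
    HSop.j e (HSop.lf e a x) = a * HSop.j e x := rfl

lemma HSop.norm_lf (e : HilbertBasis ι ℂ H) (a : H →L[ℂ] H) (x : HSop e) :
    ‖HSop.lf e a x‖ ≤ 1 * ‖a‖ * ‖x‖ := by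
  rw [one_mul, HSop.norm_eq, HSop.norm_eq x]
  exact sqrt_aux (norm_nonneg _) (hs_left e a (HSop.hs x)).2

/-- Left multiplication, as a bilinear map. -/
def HSop.lb (e : HilbertBasis ι ℂ H) : (H →L[ℂ] H) →ₗ[ℝ] HSop e →ₗ[ℝ] HSop e :=
  LinearMap.mk₂ ℝ (HSop.lf e)
      (fun a b x => HSop.j_inj e (by simp only [map_add, HSop.j_lf, add_mul, mul_add]))
      (fun c a x => HSop.j_inj e (by simp only [map_smul, HSop.j_lf, smul_mul_assoc, mul_smul_comm]))
      (fun a x y => HSop.j_inj e (by simp only [map_add, HSop.j_lf, add_mul, mul_add]))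
      (fun c a x => HSop.j_inj e (by simp only [map_smul, HSop.j_lf, smul_mul_assoc, mul_smul_comm]))

/-- Left multiplication. -/
def HSop.l (e : HilbertBasis ι ℂ H) : (H →L[ℂ] H) →L[ℝ] HSop e →L[ℝ] HSop e :=
  LinearMap.mkContinuous₂ (HSop.lb e) 1 (HSop.norm_lf e)

/-- Right multiplication, as a function. -/
def HSop.rf (e : HilbertBasis ι ℂ H) (a : H →L[ℂ] H) (x : HSop e) : HSop e :=
  HSop.mk e (HSop.j e x * a) (hs_right e a (HSop.hs x)).1

lemma HSop.j_rf (e : HilbertBasis ι ℂ H) (a : H →L[ℂ] H) (x : HSop e) :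
    HSop.j e (HSop.rf e a x) = HSop.j e x * a := rfl

lemma HSop.norm_rf (e : HilbertBasis ι ℂ H) (a : H →L[ℂ] H) (x : HSop e) :
    ‖HSop.rf e a x‖ ≤ 1 * ‖a‖ * ‖x‖ := by
  rw [one_mul, HSop.norm_eq, HSop.norm_eq x]
  exact sqrt_aux (norm_nonneg _) (hs_right e a (HSop.hs x)).2

/-- Right multiplication, as a bilinear map. -/
def HSop.rb (e : HilbertBasis ι ℂ H) : (H →L[ℂ] H) →ₗ[ℝ] HSop e →ₗ[ℝ] HSop e :=
  LinearMap.mk₂ ℝ (HSop.rf e)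
      (fun a b x => HSop.j_inj e (by simp only [map_add, HSop.j_rf, add_mul, mul_add]))
      (fun c a x => HSop.j_inj e (by simp only [map_smul, HSop.j_rf, smul_mul_assoc, mul_smul_comm]))
      (fun a x y => HSop.j_inj e (by simp only [map_add, HSop.j_rf, add_mul, mul_add]))
      (fun c a x => HSop.j_inj e (by simp only [map_smul, HSop.j_rf, smul_mul_assoc, mul_smul_comm]))

/-- Right multiplication. -/
def HSop.r (e : HilbertBasis ι ℂ H) : (H →L[ℂ] H) →L[ℝ] HSop e →L[ℝ] HSop e :=
  LinearMap.mkContinuous₂ (HSop.rb e) 1 (HSop.norm_rf e)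

lemma HSop.j_l (e : HilbertBasis ι ℂ H) (a : H →L[ℂ] H) (x : HSop e) :
    HSop.j e (HSop.l e a x) = a * HSop.j e x := rfl

lemma HSop.j_r (e : HilbertBasis ι ℂ H) (a : H →L[ℂ] H) (x : HSop e) :
    HSop.j e (HSop.r e a x) = HSop.j e x * a := rfl

lemma HSop.norm_l (e : HilbertBasis ι ℂ H) (a : H →L[ℂ] H) (x : HSop e) :
    ‖HSop.l e a x‖ ≤ ‖a‖ * ‖x‖ := by
  rw [HSop.norm_eq, HSop.norm_eq x]
  exact sqrt_aux (norm_nonneg _) (hs_left e a (HSop.hs x)).2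

lemma HSop.norm_r (e : HilbertBasis ι ℂ H) (a : H →L[ℂ] H) (x : HSop e) :
    ‖HSop.r e a x‖ ≤ ‖a‖ * ‖x‖ := by
  rw [HSop.norm_eq, HSop.norm_eq x]
  exact sqrt_aux (norm_nonneg _) (hs_right e a (HSop.hs x)).2

lemma HSop.smul_snd {e : HilbertBasis ι ℂ H} (c : ℝ) (x : HSop e) :
    (c • x).1.2 = (c : ℂ) • x.1.2 := by
  ext i; exact (Complex.coe_smul c _).symm

/-- The real inner product, as a function. -/
def HSop.βf (e : HilbertBasis ι ℂ H) (x y : HSop e) : ℝ := (inner ℂ x.1.2 y.1.2 : ℂ).re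

lemma HSop.norm_βf (e : HilbertBasis ι ℂ H) (x y : HSop e) :
    ‖HSop.βf e x y‖ ≤ 1 * ‖x‖ * ‖y‖ := by
  rw [one_mul, HSop.norm_eq', HSop.norm_eq']
  exact (Complex.abs_re_le_norm _).trans (norm_inner_le_norm _ _)

/-- The real inner product, as a bilinear map. -/
def HSop.βb (e : HilbertBasis ι ℂ H) : HSop e →ₗ[ℝ] HSop e →ₗ[ℝ] ℝ :=
    LinearMap.mk₂ ℝ (HSop.βf e)
      (fun x y z => by
        have h : (x + y).1.2 = x.1.2 + y.1.2 := rfl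
        unfold HSop.βf
        rw [h, inner_add_left, Complex.add_re])
      (fun c x y => by
        unfold HSop.βf
        rw [HSop.smul_snd, inner_smul_left, Complex.conj_ofReal, Complex.re_ofReal_mul,
          smul_eq_mul])
      (fun x y z => by
        have h : (y + z).1.2 = y.1.2 + z.1.2 := rfl
        unfold HSop.βf
        rw [h, inner_add_right, Complex.add_re])
      (fun c x y => by
        unfold HSop.βf
        rw [HSop.smul_snd, inner_smul_right, Complex.re_ofReal_mul,
          smul_eq_mul])

/-- The real inner product. -/
def HSop.β (e : HilbertBasis ι ℂ H) : HSop e →L[ℝ] HSop e →L[ℝ] ℝ :=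
  LinearMap.mkContinuous₂ (HSop.βb e) 1 (HSop.norm_βf e)

lemma HSop.β_apply (e : HilbertBasis ι ℂ H) (x y : HSop e) :
    HSop.β e x y = (inner ℂ x.1.2 y.1.2 : ℂ).re := rfl

lemma HSop.β_self (e : HilbertBasis ι ℂ H) (x : HSop e) : HSop.β e x x = ‖x‖ ^ 2 := by
  rw [HSop.β_apply, HSop.norm_eq', inner_self_eq_norm_sq_to_K]
  norm_cast

lemma HSop.β_le (e : HilbertBasis ι ℂ H) (x y : HSop e) : HSop.β e x y ≤ ‖x‖ * ‖y‖ := by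
  rw [HSop.β_apply, HSop.norm_eq', HSop.norm_eq']
  exact (Complex.re_le_norm _).trans (norm_inner_le_norm _ _)

lemma HSop.β_symm (e : HilbertBasis ι ℂ H) (x y : HSop e) : HSop.β e x y = HSop.β e y x := by
  rw [HSop.β_apply, HSop.β_apply, ← inner_conj_symm, Complex.conj_re]

lemma HSop.β_l (e : HilbertBasis ι ℂ H) (a : H →L[ℂ] H) (ha : IsSelfAdjoint a) (x y : HSop e) :
    HSop.β e x (HSop.l e a y) = HSop.β e (HSop.l e a x) y := by
  rw [HSop.β_apply, HSop.β_apply, lp.inner_eq_tsum, lp.inner_eq_tsum]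
  congr 2
  funext i
  rw [← x.2 i, ← y.2 i, ← (HSop.l e a y).2 i, ← (HSop.l e a x).2 i]
  change inner ℂ _ (a (y.1.1 (e i))) = inner ℂ (a (x.1.1 (e i))) _
  rw [← ContinuousLinearMap.adjoint_inner_left, ← ContinuousLinearMap.star_eq_adjoint, ha.star_eq]

/-- Adjoint. -/
def HSop.st (e : HilbertBasis ι ℂ H) (x : HSop e) : HSop e :=
  HSop.mk e (star (HSop.j e x)) (hs_adj e (HSop.hs x)).1

lemma HSop.norm_st (e : HilbertBasis ι ℂ H) (x : HSop e) : ‖HSop.st e x‖ = ‖x‖ := by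
  rw [HSop.norm_eq, HSop.norm_eq, ← (hs_adj e (HSop.hs x)).2]; rfl

lemma HSop.β_polar (e : HilbertBasis ι ℂ H) (x y : HSop e) :
    HSop.β e x y = (‖x + y‖ ^ 2 - ‖x - y‖ ^ 2) / 4 := by
  rw [← HSop.β_self, ← HSop.β_self]
  simp only [map_add, map_sub, add_apply, sub_apply]
  rw [HSop.β_symm e y x]; ring

lemma HSop.β_st (e : HilbertBasis ι ℂ H) (x y : HSop e) :
    HSop.β e (HSop.st e x) (HSop.st e y) = HSop.β e x y := by
  rw [HSop.β_polar, HSop.β_polar]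
  have h1 : HSop.st e x + HSop.st e y = HSop.st e (x + y) :=
    HSop.j_inj e (by simp [HSop.st])
  have h2 : HSop.st e x - HSop.st e y = HSop.st e (x - y) :=
    HSop.j_inj e (by simp [HSop.st])
  rw [h1, h2, HSop.norm_st, HSop.norm_st]

lemma HSop.β_r (e : HilbertBasis ι ℂ H) (a : H →L[ℂ] H) (ha : IsSelfAdjoint a) (x y : HSop e) :
    HSop.β e x (HSop.r e a y) = HSop.β e (HSop.r e a x) y := by
  have h : ∀ z, HSop.st e (HSop.r e a z) = HSop.l e a (HSop.st e z) := fun z =>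
    HSop.j_inj e (by
      rw [HSop.j_l]
      simp only [HSop.st, HSop.j_mk, HSop.j_r, star_mul, ha.star_eq])
  rw [← HSop.β_st, h, HSop.β_l e a ha, ← h, HSop.β_st]

end hsPart
section finalPart

lemma spec_bound {Z : H →L[ℂ] H} (hZ : IsSelfAdjoint Z) {x : ℝ} (hx : x ∈ spectrum ℝ Z) :
    |x| ≤ ‖Z‖ := by
  have h := norm_apply_le_norm_cfc (fun x : ℝ => x) Z hx (by fun_prop) hZ
  rwa [cfc_id' ℝ Z hZ, Real.norm_eq_abs] at h

lemma norm_exp_le_sa {Z : H →L[ℂ] H} (hZ : IsSelfAdjoint Z) :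
    ‖NormedSpace.exp Z‖ ≤ Real.exp ‖Z‖ := by
  rw [← CFC.real_exp_eq_normedSpace_exp hZ]
  refine norm_cfc_le (Real.exp_pos _).le fun x hx => ?_
  rw [Real.norm_eq_abs, abs_of_pos (Real.exp_pos _)]
  exact Real.exp_le_exp.2 ((le_abs_self x).trans (spec_bound hZ hx))

lemma exp_smul_cfc (a : ℝ) {Z : H →L[ℂ] H} (hZ : IsSelfAdjoint Z) :
    NormedSpace.exp (a • Z) = cfc (fun x : ℝ => Real.exp (a * x)) Z := by
  have hs : IsSelfAdjoint (a • Z) := IsSelfAdjoint.smul (IsSelfAdjoint.all a) hZ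
  rw [← CFC.real_exp_eq_normedSpace_exp hs,
    cfc_comp' Real.exp (fun x => a * x) Z (by fun_prop) (by fun_prop) hZ]
  rw [cfc_const_mul a (fun x : ℝ => x) Z, cfc_id' ℝ Z hZ]

lemma norm_le_of_exp {Z : H →L[ℂ] H} (hZ : IsSelfAdjoint Z) {c : ℝ} (hc : 0 ≤ c)
    (h1 : ‖NormedSpace.exp Z‖ ≤ Real.exp c) (h2 : ‖NormedSpace.exp (-Z)‖ ≤ Real.exp c) :
    ‖Z‖ ≤ c := by
  have h2' : -Z = (-1 : ℝ) • Z := by simp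
  rw [h2', exp_smul_cfc _ hZ] at h2
  rw [← CFC.real_exp_eq_normedSpace_exp hZ] at h1
  have : ‖cfc (fun x : ℝ => x) Z‖ ≤ c := by
    refine norm_cfc_le hc fun x hx => ?_
    have a1 := (norm_apply_le_norm_cfc Real.exp Z hx (by fun_prop) hZ).trans h1
    have a2 := (norm_apply_le_norm_cfc (fun x : ℝ => Real.exp (-1 * x)) Z hx (by fun_prop) hZ).trans h2
    rw [Real.norm_eq_abs, abs_of_pos (Real.exp_pos _), Real.exp_le_exp] at a1 a2
    rw [Real.norm_eq_abs, abs_le]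
    constructor <;> linarith
  rwa [cfc_id' ℝ Z hZ] at this

lemma psqrt_exp {A : H →L[ℂ] H} (hA : IsSelfAdjoint A) :
    psqrt (NormedSpace.exp A) = NormedSpace.exp ((1 / 2 : ℝ) • A) := by
  rw [psqrt, exp_smul_cfc _ hA, ← CFC.real_exp_eq_normedSpace_exp hA,
    ← cfc_comp' Real.sqrt Real.exp A (by fun_prop) (by fun_prop) hA]
  congr 1
  funext x
  rw [← Real.exp_half]; congr 1; ring

lemma pinvsqrt_exp {A : H →L[ℂ] H} (hA : IsSelfAdjoint A) :
    pinvsqrt (NormedSpace.exp A) = NormedSpace.exp ((-1 / 2 : ℝ) • A) := by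
  rw [pinvsqrt, exp_smul_cfc _ hA, ← CFC.real_exp_eq_normedSpace_exp hA,
    ← cfc_comp' (fun t : ℝ => (Real.sqrt t)⁻¹) Real.exp A ?_ (by fun_prop) hA]
  · congr 1
    funext x
    rw [← Real.exp_half, ← Real.exp_neg]; congr 1; ring
  · refine ContinuousOn.inv₀ (by fun_prop) ?_
    rintro _ ⟨y, -, rfl⟩
    exact (Real.sqrt_pos.2 (Real.exp_pos y)).ne'

lemma plog_exp {A : H →L[ℂ] H} (hA : IsSelfAdjoint A) : plog (NormedSpace.exp A) = A :=
  CFC.log_exp A hA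

lemma exp_smul_mul (X : H →L[ℂ] H) (a b : ℝ) :
    NormedSpace.exp (a • X) * NormedSpace.exp (b • X) = NormedSpace.exp ((a + b) • X) := by
  let _ : NormedAlgebra ℚ (H →L[ℂ] H) := NormedAlgebra.restrictScalars ℚ ℝ _
  rw [add_smul, NormedSpace.exp_add_of_commute]
  exact ((Commute.refl X).smul_left a).smul_right b

lemma exp_mul_neg (X : H →L[ℂ] H) : NormedSpace.exp X * NormedSpace.exp (-X) = 1 := by
  have := exp_smul_mul X 1 (-1)
  simpa using this

lemma exp_neg_mul (X : H →L[ℂ] H) : NormedSpace.exp (-X) * NormedSpace.exp X = 1 := by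
  have := exp_smul_mul X (-1) 1
  simpa using this

lemma p0_pos {X Y : H →L[ℂ] H} (hX : IsSelfAdjoint X) (hY : IsSelfAdjoint Y) :
    IsStrictlyPositive (NormedSpace.exp X * NormedSpace.exp Y * NormedSpace.exp X) := by
  rw [CStarAlgebra.isStrictlyPositive_iff_eq_star_mul_self]
  refine ⟨NormedSpace.exp ((1 / 2 : ℝ) • Y) * NormedSpace.exp X, ?_, ?_⟩
  · have hu : ∀ Z : H →L[ℂ] H, IsUnit (NormedSpace.exp Z) := fun Z =>
      ⟨⟨_, _, exp_mul_neg Z, exp_neg_mul Z⟩, rfl⟩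
    exact (hu _).mul (hu _)
  · have h1 : IsSelfAdjoint (NormedSpace.exp ((1 / 2 : ℝ) • Y)) :=
      (IsSelfAdjoint.smul (IsSelfAdjoint.all _) hY).exp
    rw [star_mul, hX.exp.star_eq, h1.star_eq]
    have := exp_smul_mul Y (1 / 2) (1 / 2)
    norm_num at this
    rw [← this]
    noncomm_ring

lemma exp_plog {p : H →L[ℂ] H} (hp : IsStrictlyPositive p) : NormedSpace.exp (plog p) = p :=
  CFC.exp_log p hp

lemma plog_sa (p : H →L[ℂ] H) : IsSelfAdjoint (plog p) := cfc_predicate _ _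

lemma hs_add (e : HilbertBasis ι ℂ H) {A B : H →L[ℂ] H} (hA : IsHS e A) (hB : IsHS e B) :
    IsHS e (A + B) := by
  have := HSop.hs (HSop.mk e A hA + HSop.mk e B hB)
  rwa [map_add] at this

lemma hs_exp_sub (e : HilbertBasis ι ℂ H) {Y : H →L[ℂ] H} (hY : IsHS e Y) :
    IsHS e (NormedSpace.exp Y - 1) := by
  have h := duhamel (HSop.l e) (HSop.r e) (HSop.j e) (HSop.j_l e) (HSop.j_r e) Y 0
    (HSop.mk e Y hY) (by simp)
  rw [NormedSpace.exp_zero] at h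
  rw [← h]
  exact HSop.hs _

lemma hs_plog (e : HilbertBasis ι ℂ H) {p : H →L[ℂ] H} (hp : IsStrictlyPositive p)
    (h : IsHS e (p - 1)) : IsHS e (plog p) := by
  have hsa : IsSelfAdjoint p := hp.isSelfAdjoint
  have hsp : ∀ x ∈ spectrum ℝ p, 0 < x := fun x hx => hp.spectrum_pos hx
  have hc : ContinuousOn (dslope Real.log 1) (spectrum ℝ p) := by
    have : ContinuousOn (dslope Real.log 1) (Set.Ioi 0) := by
      rw [continuousOn_dslope (Ioi_mem_nhds one_pos)]
      exact ⟨Real.continuousOn_log.mono fun x hx => (ne_of_gt hx : x ≠ 0),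
        Real.differentiableAt_log one_ne_zero⟩
    exact this.mono hsp
  have h1 : plog p = cfc (dslope Real.log 1) p * (p - 1) := by
    have h2 : p - 1 = cfc (fun x : ℝ => x - 1) p := by
      rw [cfc_sub (fun x : ℝ => x) (fun _ => (1:ℝ)) p, cfc_id' ℝ p hsa, cfc_const_one ℝ p hsa]
    rw [h2, ← cfc_mul _ _ p hc (by fun_prop), plog]
    congr 1
    funext x
    have := sub_smul_dslope Real.log 1 x
    rw [Real.log_one, sub_zero, smul_eq_mul] at this
    rw [mul_comm, this]
  rw [h1]
  exact (hs_left e _ h).1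

lemma hs_p0 (e : HilbertBasis ι ℂ H) {X Y : H →L[ℂ] H} (hX : IsHS e X) (hY : IsHS e Y) :
    IsHS e (NormedSpace.exp X * NormedSpace.exp Y * NormedSpace.exp X - 1) := by
  have h1 := (hs_right e (NormedSpace.exp X) (hs_left e (NormedSpace.exp X) (hs_exp_sub e hY)).1).1
  have h2 := (hs_right e (NormedSpace.exp X) (hs_exp_sub e hX)).1
  have := hs_add e (hs_add e h1 h2) (hs_exp_sub e hX)
  convert! this using 1
  noncomm_ring

lemma ES_closed (e : HilbertBasis ι ℂ H) (E : Submodule ℝ (H →L[ℂ] H))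
    (hE : ∀ X ∈ E, MemS2 e X) (hclosed : IsHSClosed e (E : Set (H →L[ℂ] H))) :
    IsClosed ((E.comap (HSop.j e : HSop e →ₗ[ℝ] (H →L[ℂ] H)) : Submodule ℝ (HSop e)) :
      Set (HSop e)) := by
  rw [← closure_subset_iff_isClosed]
  intro x hx
  refine hclosed _ ⟨?_, HSop.hs x⟩ ?_
  · have hc : IsClosed {y : HSop e | IsSelfAdjoint (HSop.j e y)} := by
      change IsClosed {y : HSop e | star (HSop.j e y) = HSop.j e y}
      exact isClosed_eq ((HSop.j e).continuous.star) (HSop.j e).continuous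
    have hsub : ((E.comap (HSop.j e : HSop e →ₗ[ℝ] (H →L[ℂ] H)) : Submodule ℝ (HSop e)) :
        Set (HSop e)) ⊆ {y : HSop e | IsSelfAdjoint (HSop.j e y)} :=
      fun y hy => (hE (HSop.j e y) hy).1
    exact (closure_minimal hsub hc) hx
  · intro ε hε
    obtain ⟨y, hy, hxy⟩ := Metric.mem_closure_iff.1 hx ε hε
    refine ⟨HSop.j e y, hy, ?_⟩
    rw [dist_eq_norm, HSop.norm_eq, map_sub] at hxy
    exact hxy

lemma norm_exp_smul_le {Z : H →L[ℂ] H} (hZ : IsSelfAdjoint Z) {a c : ℝ} (ha : |a| ≤ 1)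
    (hc : ‖Z‖ ≤ c) : ‖NormedSpace.exp (a • Z)‖ ≤ Real.exp c := by
  refine (norm_exp_le_sa (IsSelfAdjoint.smul (IsSelfAdjoint.all a) hZ)).trans
    (Real.exp_le_exp.2 ?_)
  rw [norm_smul, Real.norm_eq_abs]
  nlinarith [norm_nonneg Z]

lemma norm_sandwich {X K : H →L[ℂ] H} (hX : IsSelfAdjoint X) (hK : IsSelfAdjoint K) {a b : ℝ}
    (ha : |a| ≤ 1) (hb : |b| ≤ 1) :
    ‖NormedSpace.exp (a • X) * NormedSpace.exp (b • K) * NormedSpace.exp (a • X)‖ ≤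
      Real.exp (2 * ‖X‖ + ‖K‖) := by
  have h1 := norm_exp_smul_le hX ha le_rfl
  have h2 := norm_exp_smul_le hK hb le_rfl
  have : Real.exp (2 * ‖X‖ + ‖K‖) = Real.exp ‖X‖ * Real.exp ‖K‖ * Real.exp ‖X‖ := by
    rw [← Real.exp_add, ← Real.exp_add]; congr 1; ring
  rw [this]
  calc _ ≤ ‖NormedSpace.exp (a • X)‖ * ‖NormedSpace.exp (b • K)‖ * ‖NormedSpace.exp (a • X)‖ :=
        norm_mul₃_le
    _ ≤ _ := by gcongr

lemma statement_mpr (e : HilbertBasis ι ℂ H) (E : Submodule ℝ (H →L[ℂ] H))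
    (hE : ∀ X ∈ E, MemS2 e X) (hclosed : IsHSClosed e (E : Set (H →L[ℂ] H)))
    (hbrk : ∀ X ∈ E, ∀ Y ∈ E, brk X (brk X Y) ∈ E)
    (hgeo : ∀ p ∈ expSet (E : Set (H →L[ℂ] H)), ∀ q ∈ expSet (E : Set (H →L[ℂ] H)),
      ∀ t ∈ Set.Icc (0:ℝ) 1, geodesic p q t ∈ expSet (E : Set (H →L[ℂ] H)))
    (X : H →L[ℂ] H) (hXE : X ∈ E) (Y : H →L[ℂ] H) (hYE : Y ∈ E) :
    NormedSpace.exp X * NormedSpace.exp Y * NormedSpace.exp X ∈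
        expSet (E : Set (H →L[ℂ] H)) := by
  have hX := (hE X hXE).1
  have hY := (hE Y hYE).1
  set p0 := NormedSpace.exp X * NormedSpace.exp Y * NormedSpace.exp X with hp0
  have hpos : IsStrictlyPositive p0 := p0_pos hX hY
  set K := plog p0 with hKdef
  have hK : IsSelfAdjoint K := plog_sa _
  have hexpK : NormedSpace.exp K = p0 := exp_plog hpos
  have hKhs : IsHS e K := hs_plog e hpos (hs_p0 e (hE X hXE).2 (hE Y hYE).2)
  have hA : IsSelfAdjoint ((-2 : ℝ) • X) := IsSelfAdjoint.smul (IsSelfAdjoint.all _) hX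
  have hgeod : ∀ t : ℝ, geodesic (NormedSpace.exp ((-2 : ℝ) • X)) (NormedSpace.exp Y) t =
      NormedSpace.exp (-X) * NormedSpace.exp (t • K) * NormedSpace.exp (-X) := by
    intro t
    have e1 : (1 / 2 : ℝ) • (-2 : ℝ) • X = -X := by rw [smul_smul]; norm_num
    have e2 : (-1 / 2 : ℝ) • (-2 : ℝ) • X = X := by rw [smul_smul]; norm_num
    rw [geodesic, geoCurve, psqrt_exp hA, pinvsqrt_exp hA, e1, e2]
  have hex : ∀ n : ℕ, ∃ Z ∈ E, NormedSpace.exp Z = NormedSpace.exp (-X) *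
      NormedSpace.exp ((1 / ((n : ℝ) + 1)) • K) * NormedSpace.exp (-X) := by
    intro n
    have h := hgeo _ ⟨(-2 : ℝ) • X, E.smul_mem _ hXE, rfl⟩ _ ⟨Y, hYE, rfl⟩ (1 / ((n : ℝ) + 1))
      ⟨by positivity, by rw [div_le_one (by positivity)]; linarith [(Nat.cast_nonneg n : (0:ℝ) ≤ n)]⟩
    rw [hgeod] at h
    obtain ⟨Z, hZ, h⟩ := h
    exact ⟨Z, hZ, h⟩
  choose Z hZE hZ using hex
  have hZs : ∀ n, IsSelfAdjoint (Z n) := fun n => (hE _ (hZE n)).1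
  have hdE : ∀ n, Z n - (-2 : ℝ) • X ∈ E := fun n => E.sub_mem (hZE n) (E.smul_mem _ hXE)
  set c := 2 * ‖X‖ + ‖K‖ with hc
  have hc0 : 0 ≤ c := by positivity
  have ht : ∀ n : ℕ, |1 / ((n : ℝ) + 1)| ≤ 1 := fun n => by
    rw [abs_of_nonneg (by positivity), div_le_one (by positivity)]
    linarith [(Nat.cast_nonneg n : (0:ℝ) ≤ n)]
  have hZn : ∀ n, ‖Z n‖ ≤ c := by
    intro n
    refine norm_le_of_exp (hZs n) hc0 ?_ ?_
    · rw [hZ n]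
      have := norm_sandwich hX hK (a := -1) (b := 1 / ((n : ℝ) + 1)) (by simp) (ht n)
      simpa only [neg_smul, one_smul] using this
    · have hinv : NormedSpace.exp (-(Z n)) = NormedSpace.exp X *
          NormedSpace.exp (-((1 / ((n : ℝ) + 1)) • K)) * NormedSpace.exp X := by
        refine left_inv_eq_right_inv (exp_neg_mul (Z n)) ?_
        rw [hZ n]
        set k := (1 / ((n : ℝ) + 1)) • K
        calc _ = NormedSpace.exp (-X) * (NormedSpace.exp k * (NormedSpace.exp (-X) *
              NormedSpace.exp X) * NormedSpace.exp (-k)) * NormedSpace.exp X := by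
                simp only [mul_assoc]
          _ = 1 := by rw [exp_neg_mul, mul_one, exp_mul_neg, mul_one, exp_neg_mul]
      rw [hinv]
      have := norm_sandwich hX hK (a := 1) (b := -(1 / ((n : ℝ) + 1))) (by simp)
        (by rw [abs_neg]; exact ht n)
      simpa only [neg_smul, one_smul] using this
  have hAn : ‖(-2 : ℝ) • X‖ ≤ c := by
    rw [norm_smul, hc]; norm_num
  have hs2 : ∀ s ∈ Set.Icc (0:ℝ) 1, |-(s / 2)| ≤ 1 := fun s hs => by
    rw [abs_neg, abs_of_nonneg (by linarith [hs.1])]; linarith [hs.2]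
  have hmem := core (HSop.l e) (HSop.r e) (HSop.j e) (HSop.j_inj e) (HSop.j_l e) (HSop.j_r e)
    (E.comap (HSop.j e : HSop e →ₗ[ℝ] (H →L[ℂ] H))) (ES_closed e E hE hclosed) X K
    (by
      intro w hw
      have h := hbrk X hXE _ hw
      rw [Submodule.mem_comap]
      convert! h using 1)
    (HSop.mk e K hKhs) rfl Z (fun n => HSop.mk e _ (hE _ (hdE n)).2) (fun n => hdE n)
    (fun n => rfl) hZ (Real.exp c ^ 4)
    (fun n w => Phi_low (HSop.l e) (HSop.r e) (HSop.j e) (HSop.j_inj e) (HSop.j_l e) (HSop.j_r e)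
      (HSop.norm_l e) (HSop.norm_r e) (HSop.β e) (HSop.β_self e) (HSop.β_le e) (HSop.β_l e)
      (HSop.β_r e) (Z n) _ (hZs n) hA (Real.exp c) (Real.exp_pos c).le
      (fun s hs => norm_exp_smul_le (hZs n) (hs2 s hs) (hZn n))
      (fun s hs => norm_exp_smul_le hA (hs2 s hs) hAn) w)
  exact ⟨K, hmem, hexpK⟩

end finalPart

/-- For a closed subspace `E` of `S₂(H)` with `[X,[X,Y]] ∈ E` for
`X, Y ∈ E`: `exp X exp Y exp X ∈ exp E` for all `X, Y ∈ E` iff `exp E` is totally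
geodesic in `P`. -/
theorem statement11 (e : HilbertBasis ι ℂ H) (E : Submodule ℝ (H →L[ℂ] H))
    (hE : ∀ X ∈ E, MemS2 e X) (hclosed : IsHSClosed e (E : Set (H →L[ℂ] H)))
    (hbrk : ∀ X ∈ E, ∀ Y ∈ E, brk X (brk X Y) ∈ E) :
    (∀ X ∈ E, ∀ Y ∈ E,
      NormedSpace.exp X * NormedSpace.exp Y * NormedSpace.exp X ∈
        expSet (E : Set (H →L[ℂ] H))) ↔
    (∀ p ∈ expSet (E : Set (H →L[ℂ] H)), ∀ q ∈ expSet (E : Set (H →L[ℂ] H)),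
      ∀ t ∈ Set.Icc (0:ℝ) 1, geodesic p q t ∈ expSet (E : Set (H →L[ℂ] H))) := by
  constructor
  · intro h p hp q hq t ht
    obtain ⟨X, hX, rfl⟩ := hp
    obtain ⟨Y, hY, rfl⟩ := hq
    have hXs := (hE X hX).1
    obtain ⟨Z, hZ, hZe⟩ := h _ (E.smul_mem (-1 / 2 : ℝ) hX) _ hY
    rw [geodesic, geoCurve, psqrt_exp hXs, pinvsqrt_exp hXs, ← hZe, plog_exp (hE Z hZ).1]
    exact h _ (E.smul_mem _ hX) _ (E.smul_mem _ hZ)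
  · intro h X hX Y hY
    exact statement_mpr e E hE hclosed hbrk h X hX Y hY
end
end
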